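/- arXiv:2004.02013 — 5 statements merged into one kernel-verified Lean document; each statement's English description precedes it below -/
import Mathlib

section
/- A separable metrizable space X is hereditarily Baire if and only if the space ℚ of rational numbers does not embed into X as a closed subspace. -/
/-- A space is hereditarily Baire if every closed subspace is a Baire space. -/
def HereditarilyBaire (X : Type*) [TopologicalSpace X] : Prop :=
  ∀ C : Set X, IsClosed C → BaireSpace C

open Topology Set Filter

namespace Hurewicz

/-- The rank of the `n`-th child of a node among its siblings; the node itself has rank `0`. -/
def rank (n : ℕ) : ℚ := (-1) ^ n / (n + 1)

lemma abs_rank (n : ℕ) : |rank n| = 1 / (n + 1) := by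
  rw [rank, abs_div, abs_pow, abs_neg, abs_one, one_pow, abs_of_pos (by positivity)]

lemma rank_ne_zero (n : ℕ) : rank n ≠ 0 := by
  rw [← abs_pos, abs_rank]; positivity

lemma abs_rank_le_iff {m n : ℕ} : |rank m| ≤ |rank n| ↔ n ≤ m := by
  rw [abs_rank, abs_rank, one_div_le_one_div (by positivity) (by positivity)]
  simp

lemma rank_injective : Function.Injective rank := fun _ _ h ↦
  le_antisymm (abs_rank_le_iff.1 (congrArg abs h).ge) (abs_rank_le_iff.1 (congrArg abs h).le)

lemma rank_even_pos (n : ℕ) : 0 < rank (2 * n) := by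
  rw [rank, pow_mul]; norm_num; positivity

lemma rank_odd_neg (n : ℕ) : rank (2 * n + 1) < 0 := by
  rw [← neg_pos, rank, pow_succ, pow_mul, ← neg_div]; norm_num; positivity

lemma rank_lt_of_pos {m n : ℕ} (hm : 0 < rank m) (h : m < n) : rank n < rank m := by
  have := not_le.1 (mt abs_rank_le_iff.1 h.not_ge)
  rw [abs_of_pos hm] at this
  exact (le_abs_self _).trans_lt this

lemma lt_rank_of_neg {m n : ℕ} (hm : rank m < 0) (h : m < n) : rank m < rank n := by
  have := not_le.1 (mt abs_rank_le_iff.1 h.not_ge)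
  rw [abs_of_neg hm] at this
  linarith [neg_abs_le (rank n)]

/-- Nodes of the tree `List ℕ` are compared through the lexicographic order of their keys. -/
def key (s : List ℕ) : List ℚ := s.map rank ++ [0]

lemma key_injective : Function.Injective key := fun _ _ h ↦
  rank_injective.list_map (List.append_cancel_right h)

@[simp] lemma key_nil_lt_key_cons {n : ℕ} {s : List ℕ} : key [] < key (n :: s) ↔ 0 < rank n := by
  simp [key, List.cons_lt_cons_iff, (rank_ne_zero n).symm]

@[simp] lemma key_cons_lt_key_nil {n : ℕ} {s : List ℕ} : key (n :: s) < key [] ↔ rank n < 0 := by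
  simp [key, List.cons_lt_cons_iff, rank_ne_zero n]

@[simp] lemma key_cons_lt_key_cons {m n : ℕ} {s t : List ℕ} :
    key (m :: s) < key (n :: t) ↔ rank m < rank n ∨ m = n ∧ key s < key t := by
  simp [key, List.cons_lt_cons_iff, rank_injective.eq_iff]

lemma exists_key_gt (s : List ℕ) : ∃ t, key s < key t := by
  cases s with
  | nil => exact ⟨[0], by simp [rank]⟩
  | cons n s =>
    induction s generalizing n with
    | nil => exact ⟨[n, 0], by simp [rank]⟩
    | cons m s ih =>
      obtain ⟨t, ht⟩ := ih m
      exact ⟨n :: t, by simp [ht]⟩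

lemma exists_key_lt (s : List ℕ) : ∃ t, key t < key s := by
  induction s with
  | nil => exact ⟨[1], by simpa using rank_odd_neg 0⟩
  | cons n s ih =>
    obtain ⟨t, ht⟩ := ih
    exact ⟨n :: t, by simp [ht]⟩

lemma exists_key_between {s t : List ℕ} (h : key s < key t) :
    ∃ u, key s < key u ∧ key u < key t := by
  induction s generalizing t with
  | nil =>
    cases t with
    | nil => exact absurd h (lt_irrefl _)
    | cons n t =>
      rw [key_nil_lt_key_cons] at h
      exact ⟨[2 * (n + 1)], by simpa using rank_even_pos (n + 1),
        by simpa using .inl (rank_lt_of_pos h (by omega))⟩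
  | cons m s ih =>
    cases t with
    | nil =>
      rw [key_cons_lt_key_nil] at h
      exact ⟨[2 * m + 1], by simpa using .inl (lt_rank_of_neg h (by omega)),
        by simpa using rank_odd_neg m⟩
    | cons n t =>
      rw [key_cons_lt_key_cons] at h
      obtain h | ⟨rfl, h⟩ := h
      · obtain ⟨u, hu⟩ := exists_key_gt s
        exact ⟨m :: u, by simp [hu], by simp [h]⟩
      · obtain ⟨u, hu⟩ := ih h
        exact ⟨m :: u, by simp [hu], by simp [hu]⟩

/-- The nodes extending `s` whose next letter, if any, is at least `N`. -/
def tail (s : List ℕ) (N : ℕ) : Set (List ℕ) := {t | ∃ r, t = s ++ r ∧ ∀ m ∈ r.head?, N ≤ m}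

lemma mem_tail_nil {N : ℕ} {t : List ℕ} : t ∈ tail [] N ↔ ∀ m ∈ t.head?, N ≤ m := by
  simp [tail]

lemma mem_tail_cons {N n : ℕ} {s t : List ℕ} :
    t ∈ tail (n :: s) N ↔ ∃ t' ∈ tail s N, t = n :: t' := by
  simp only [tail, mem_ofPred_eq, List.cons_append]
  grind

lemma exists_tail_subset_Ioi {s a : List ℕ} (h : key a < key s) :
    ∃ N, ∀ t ∈ tail s N, key a < key t := by
  induction s generalizing a with
  | nil =>
    cases a with
    | nil => exact absurd h (lt_irrefl _)
    | cons n a =>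
      rw [key_cons_lt_key_nil] at h
      refine ⟨n + 1, fun t ht ↦ ?_⟩
      rw [mem_tail_nil] at ht
      cases t with
      | nil => simpa using h
      | cons m t => simpa using .inl (lt_rank_of_neg h (by simpa using ht))
  | cons m s ih =>
    simp only [mem_tail_cons]
    cases a with
    | nil => exact ⟨0, by rintro _ ⟨t, -, rfl⟩; simpa using h⟩
    | cons n a =>
      rw [key_cons_lt_key_cons] at h
      obtain h | ⟨rfl, h⟩ := h
      · exact ⟨0, by rintro _ ⟨t, -, rfl⟩; simp [h]⟩
      · obtain ⟨N, hN⟩ := ih h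
        exact ⟨N, by rintro _ ⟨t, ht, rfl⟩; simp [hN t ht]⟩

lemma exists_tail_subset_Iio {s b : List ℕ} (h : key s < key b) :
    ∃ N, ∀ t ∈ tail s N, key t < key b := by
  induction s generalizing b with
  | nil =>
    cases b with
    | nil => exact absurd h (lt_irrefl _)
    | cons n b =>
      rw [key_nil_lt_key_cons] at h
      refine ⟨n + 1, fun t ht ↦ ?_⟩
      rw [mem_tail_nil] at ht
      cases t with
      | nil => simpa using h
      | cons m t => simpa using .inl (rank_lt_of_pos h (by simpa using ht))
  | cons m s ih =>
    simp only [mem_tail_cons]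
    cases b with
    | nil => exact ⟨0, by rintro _ ⟨t, -, rfl⟩; simpa using h⟩
    | cons n b =>
      rw [key_cons_lt_key_cons] at h
      obtain h | ⟨rfl, h⟩ := h
      · exact ⟨0, by rintro _ ⟨t, -, rfl⟩; simp [h]⟩
      · obtain ⟨N, hN⟩ := ih h
        exact ⟨N, by rintro _ ⟨t, ht, rfl⟩; simp [hN t ht]⟩

lemma exists_Ioo_subset_tail (s : List ℕ) (N : ℕ) : ∃ a b, key a < key s ∧ key s < key b ∧
    ∀ t, key a < key t → key t < key b → t ∈ tail s N := by
  induction s with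
  | nil =>
    refine ⟨[2 * N + 1], [2 * N], by simpa using rank_odd_neg N, by simpa using rank_even_pos N,
      fun t hat htb ↦ mem_tail_nil.2 ?_⟩
    cases t with
    | nil => simp
    | cons m t =>
      have ha : rank (2 * N + 1) ≤ rank m := by
        obtain h | ⟨rfl, -⟩ := key_cons_lt_key_cons.1 hat
        exacts [h.le, le_rfl]
      have hb : rank m ≤ rank (2 * N) := by
        obtain h | ⟨rfl, -⟩ := key_cons_lt_key_cons.1 htb
        exacts [h.le, le_rfl]
      suffices N ≤ m by simpa
      by_contra! h
      obtain hm | hm := (rank_ne_zero m).lt_or_gt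
      · exact ha.not_gt (lt_rank_of_neg hm (by omega))
      · exact hb.not_gt (rank_lt_of_pos hm (by omega))
  | cons m s ih =>
    obtain ⟨a, b, ha, hb, h⟩ := ih
    refine ⟨m :: a, m :: b, by simp [ha], by simp [hb], fun t hat htb ↦ mem_tail_cons.2 ?_⟩
    cases t with
    | nil =>
      rw [key_cons_lt_key_nil] at hat
      rw [key_nil_lt_key_cons] at htb
      exact absurd hat htb.not_gt
    | cons n t =>
      rw [key_cons_lt_key_cons] at hat htb
      obtain h1 | ⟨rfl, h1⟩ := hat
      · obtain h2 | ⟨rfl, -⟩ := htb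
        exacts [absurd h1 h2.not_gt, absurd h1 (lt_irrefl _)]
      · exact ⟨t, h t h1 (by simpa using htb), rfl⟩

lemma exists_rat_enumeration :
    ∃ g : ℚ → List ℕ, Function.Surjective g ∧ ∀ p q, key (g p) < key (g q) ↔ p < q := by
  have : DenselyOrdered (range key) := ⟨by
    rintro ⟨_, s, rfl⟩ ⟨_, t, rfl⟩ h
    obtain ⟨u, hu⟩ := exists_key_between h
    exact ⟨⟨_, u, rfl⟩, hu⟩⟩
  have : NoMaxOrder (range key) := ⟨by
    rintro ⟨_, s, rfl⟩
    obtain ⟨u, hu⟩ := exists_key_gt s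
    exact ⟨⟨_, u, rfl⟩, hu⟩⟩
  have : NoMinOrder (range key) := ⟨by
    rintro ⟨_, s, rfl⟩
    obtain ⟨u, hu⟩ := exists_key_lt s
    exact ⟨⟨_, u, rfl⟩, hu⟩⟩
  obtain ⟨e⟩ := Order.iso_of_countable_dense ℚ (range key)
  choose g hg using fun q ↦ (e q).2
  refine ⟨g, fun s ↦ ⟨e.symm ⟨key s, s, rfl⟩, key_injective ?_⟩, fun p q ↦ ?_⟩
  · simp [hg]
  · rw [hg, hg, Subtype.coe_lt_coe, e.lt_iff_lt]

lemma nhds_hasBasis_tail {g : ℚ → List ℕ} (hsurj : Function.Surjective g)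
    (hg : ∀ p q, key (g p) < key (g q) ↔ p < q) (q : ℚ) :
    (𝓝 q).HasBasis (fun _ : ℕ ↦ True) fun N ↦ g ⁻¹' tail (g q) N := by
  refine ⟨fun U ↦ ⟨fun hU ↦ ?_, ?_⟩⟩
  · obtain ⟨a, b, ⟨ha, hb⟩, hU⟩ := mem_nhds_iff_exists_Ioo_subset.1 hU
    obtain ⟨M, hM⟩ := exists_tail_subset_Ioi ((hg a q).2 ha)
    obtain ⟨N, hN⟩ := exists_tail_subset_Iio ((hg q b).2 hb)
    refine ⟨max M N, trivial, fun p hp ↦ hU ⟨(hg _ _).1 (hM _ ?_), (hg _ _).1 (hN _ ?_)⟩⟩ <;>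
    · obtain ⟨r, hr, h⟩ := hp
      exact ⟨r, hr, fun m hm ↦ le_trans (by simp) (h m hm)⟩
  · rintro ⟨N, -, hN⟩
    obtain ⟨a, b, ha, hb, h⟩ := exists_Ioo_subset_tail (g q) N
    obtain ⟨a, rfl⟩ := hsurj a
    obtain ⟨b, rfl⟩ := hsurj b
    refine mem_of_superset (Ioo_mem_nhds ((hg _ _).1 ha) ((hg _ _).1 hb)) fun p hp ↦ hN ?_
    exact h _ ((hg _ _).2 hp.1) ((hg _ _).2 hp.2)


variable {X : Type*}

/-- A tree of points `x s` with open neighbourhoods `U s` such that the sets attached to the children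
of `s` converge to `x s`. -/
structure IsTreeScheme [TopologicalSpace X] (x : List ℕ → X) (U : List ℕ → Set X) : Prop where
  isOpen (s : List ℕ) : IsOpen (U s)
  mem (s : List ℕ) : x s ∈ U s
  closure_subset (s : List ℕ) (n : ℕ) : closure (U (s ++ [n])) ⊆ U s
  notMem (s : List ℕ) (n : ℕ) : x s ∉ closure (U (s ++ [n]))
  disjoint (s : List ℕ) : Pairwise fun m n ↦ Disjoint (U (s ++ [m])) (U (s ++ [n]))
  eventually_subset (s : List ℕ) {V : Set X} (hV : V ∈ 𝓝 (x s)) : ∀ᶠ n in atTop, U (s ++ [n]) ⊆ V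

namespace IsTreeScheme

variable [TopologicalSpace X] {x : List ℕ → X} {U : List ℕ → Set X}

lemma append_subset (h : IsTreeScheme x U) (s t : List ℕ) : U (s ++ t) ⊆ U s := by
  induction t generalizing s with
  | nil => simp
  | cons n t ih =>
    rw [List.append_cons]
    exact (ih _).trans (subset_closure.trans (h.closure_subset s n))

lemma mem_append (h : IsTreeScheme x U) (s t : List ℕ) : x (s ++ t) ∈ U s :=
  h.append_subset s t (h.mem _)

lemma mem_append_cons (h : IsTreeScheme x U) (s : List ℕ) (n : ℕ) (t : List ℕ) :
    x (s ++ n :: t) ∈ U (s ++ [n]) := by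
  simpa using h.mem_append (s ++ [n]) t

lemma exists_eq_append (h : IsTreeScheme x U) {s t : List ℕ} (ht : x t ∈ U s) :
    ∃ r, t = s ++ r := by
  induction s using List.reverseRecOn with
  | nil => exact ⟨t, rfl⟩
  | append_singleton s n ih =>
    obtain ⟨r, rfl⟩ := ih (h.closure_subset s n (subset_closure ht))
    cases r with
    | nil => exact absurd (subset_closure (by simpa using ht)) (h.notMem s n)
    | cons m r =>
      obtain rfl | hmn := eq_or_ne m n
      · exact ⟨r, by simp⟩
      · exact absurd ht ((h.disjoint s hmn).notMem_of_mem_left (h.mem_append_cons s m r))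

lemma comap_nhds_hasBasis (h : IsTreeScheme x U) (s : List ℕ) :
    ((𝓝 (x s)).comap x).HasBasis (fun _ : ℕ ↦ True) (tail s) := by
  refine ⟨fun A ↦ ⟨?_, ?_⟩⟩
  · rintro ⟨V, hV, hVA⟩
    obtain ⟨N, hN⟩ := eventually_atTop.1 (h.eventually_subset s hV)
    refine ⟨N, trivial, ?_⟩
    rintro _ ⟨r, rfl, hr⟩
    refine hVA (show x (s ++ r) ∈ V from ?_)
    cases r with
    | nil => simpa using mem_of_mem_nhds hV
    | cons n r => exact hN n (by simpa using hr) (h.mem_append_cons s n r)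
  · rintro ⟨N, -, hN⟩
    have hV : U s ∩ ⋂ n ∈ Finset.range N, (closure (U (s ++ [n])))ᶜ ∈ 𝓝 (x s) :=
      inter_mem ((h.isOpen s).mem_nhds (h.mem s)) <| (biInter_finset_mem _).2 fun n _ ↦
        isClosed_closure.isOpen_compl.mem_nhds (h.notMem s n)
    refine ⟨_, hV, fun t ht ↦ hN ?_⟩
    obtain ⟨r, rfl⟩ := h.exists_eq_append ht.1
    refine ⟨r, rfl, fun n hn ↦ ?_⟩
    obtain ⟨r, rfl⟩ := List.head?_eq_some_iff.1 hn
    by_contra! hnN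
    exact mem_iInter₂.1 ht.2 n (Finset.mem_range.2 hnN) (subset_closure (h.mem_append_cons s n r))

lemma exists_mem_closure_of_notMem_range [T2Space X] (h : IsTreeScheme x U) {p : X}
    (hp : p ∈ closure (range x)) (hpx : p ∉ range x) (k : ℕ) :
    ∃ s : List ℕ, s.length = k ∧ p ∈ closure (range fun t ↦ x (s ++ t)) := by
  induction k with
  | zero => exact ⟨[], rfl, hp⟩
  | succ k ih =>
    obtain ⟨s, hs, hps⟩ := ih
    obtain ⟨V, W, hV, hW, hxV, hpW, hVW⟩ := t2_separation fun he : x s = p ↦ hpx ⟨s, he⟩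
    obtain ⟨N, hN⟩ := eventually_atTop.1 (h.eventually_subset s (hV.mem_nhds hxV))
    have hsub : (range fun t ↦ x (s ++ t)) ⊆
        V ∪ ⋃ n ∈ Finset.range N, range fun t ↦ x (s ++ [n] ++ t) := by
      rintro _ ⟨t, rfl⟩
      cases t with
      | nil => exact .inl (by simpa using hxV)
      | cons n t =>
        obtain hn | hn := lt_or_ge n N
        · exact .inr (mem_biUnion (Finset.mem_coe.2 (Finset.mem_range.2 hn)) ⟨t, by simp⟩)
        · exact .inl (hN n hn (h.mem_append_cons s n t))
    have hpV : p ∉ closure V := fun hpV ↦ (hVW.closure_left hW).notMem_of_mem_left hpV hpW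
    have := closure_mono hsub hps
    rw [closure_union, Finset.closure_biUnion] at this
    obtain ⟨n, -, hn⟩ := mem_iUnion₂.1 (this.resolve_left hpV)
    exact ⟨s ++ [n], by simp [hs], hn⟩

lemma exists_isClosedEmbedding_rat [T2Space X] (h : IsTreeScheme x U)
    (hU : ∀ p, ∃ k, ∀ s : List ℕ, s.length = k → p ∉ closure (U s)) :
    ∃ f : ℚ → X, IsClosedEmbedding f := by
  obtain ⟨g, hsurj, hg⟩ := exists_rat_enumeration
  refine ⟨x ∘ g, (isInducing_iff_nhds.2 fun q ↦ ?_).isEmbedding, ?_⟩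
  · rw [← comap_comap]
    exact (nhds_hasBasis_tail hsurj hg q).eq_of_same_basis ((h.comap_nhds_hasBasis (g q)).comap g)
  · rw [hsurj.range_comp]
    refine isClosed_of_closure_subset fun p hp ↦ ?_
    by_contra hpx
    obtain ⟨k, hk⟩ := hU p
    obtain ⟨s, hs, hps⟩ := h.exists_mem_closure_of_notMem_range hp hpx k
    refine hk s hs (closure_mono ?_ hps)
    rintro _ ⟨t, rfl⟩
    exact h.mem_append s t

end IsTreeScheme

lemma exists_seq_converging_open_sets [MetricSpace X] {x : X} [(𝓝[≠] x).NeBot] {V G : Set X}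
    (hV : V ∈ 𝓝 x) (hGo : IsOpen G) (hGd : Dense G) :
    ∃ (y : ℕ → X) (U : ℕ → Set X), (∀ n, IsOpen (U n)) ∧ (∀ n, y n ∈ U n) ∧
      (∀ n, closure (U n) ⊆ V ∩ G) ∧ (∀ n, x ∉ closure (U n)) ∧
      (Pairwise fun m n ↦ Disjoint (U m) (U n)) ∧
      ∀ W ∈ 𝓝 x, ∀ᶠ n in atTop, U n ⊆ W := by
  obtain ⟨ε, hε, hεV⟩ := Metric.mem_nhds_iff.1 hV
  have hy (r : {r : ℝ // 0 < r}) : ∃ y ∈ G, 0 < dist y x ∧ dist y x < r := by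
    obtain ⟨y, ⟨hyG, hyx⟩, hyr⟩ := (hGd.sdiff_singleton x).exists_dist_lt x r.2
    exact ⟨y, hyG, dist_pos.2 hyx, by rwa [dist_comm]⟩
  choose Y hYG hY0 hY using hy
  let e : ℕ → {r : ℝ // 0 < r} :=
    fun n ↦ n.rec ⟨ε / 2, half_pos hε⟩ fun _ r ↦ ⟨dist (Y r) x / 4, div_pos (hY0 r) four_pos⟩
  let d (n : ℕ) : ℝ := dist (Y (e n)) x
  have hd0 (n) : 0 < d n := hY0 _
  have hd_succ (n) : d (n + 1) < d n / 4 := hY (e (n + 1))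
  have hd_anti : StrictAnti d := strictAnti_nat_of_succ_lt fun n ↦ by
    linarith [hd_succ n, hd0 n]
  have hd_le (n) : d n ≤ ε / 2 := (hd_anti.antitone n.zero_le).trans (hY (e 0)).le
  have hd_geom (n) : d n ≤ ε / 2 * (1 / 4) ^ n := by
    induction n with
    | zero => simpa using hd_le 0
    | succ n ih => rw [pow_succ]; linarith [hd_succ n]
  have hd_tendsto : Tendsto d atTop (𝓝 0) := by
    refine squeeze_zero (fun n ↦ (hd0 n).le) hd_geom ?_
    simpa using (tendsto_pow_atTop_nhds_zero_of_lt_one (r := (1 / 4 : ℝ))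
      (by norm_num) (by norm_num)).const_mul (ε / 2)
  have hρ (n) : ∃ ρ > 0, Metric.closedBall (Y (e n)) ρ ⊆ G ∧ ρ ≤ d n / 4 := by
    obtain ⟨ρ, hρ, h⟩ := Metric.nhds_basis_closedBall.mem_iff.1 (hGo.mem_nhds (hYG (e n)))
    exact ⟨min ρ (d n / 4), lt_min hρ (div_pos (hd0 n) four_pos),
      (Metric.closedBall_subset_closedBall (min_le_left _ _)).trans h, min_le_right _ _⟩
  choose ρ hρ0 hρG hρd using hρ
  have hlow {n : ℕ} {z : X} (hz : z ∈ Metric.closedBall (Y (e n)) (ρ n)) :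
      3 / 4 * d n ≤ dist z x := by
    have h1 := dist_triangle_left (Y (e n)) x z
    have h2 := Metric.mem_closedBall.1 hz
    have h3 : d n = dist (Y (e n)) x := rfl
    linarith [hρd n]
  have hhigh {n : ℕ} {z : X} (hz : z ∈ Metric.closedBall (Y (e n)) (ρ n)) :
      dist z x ≤ 5 / 4 * d n := by
    have h1 := dist_triangle z (Y (e n)) x
    have h2 := Metric.mem_closedBall.1 hz
    have h3 : d n = dist (Y (e n)) x := rfl
    linarith [hρd n]
  refine ⟨fun n ↦ Y (e n), fun n ↦ Metric.ball (Y (e n)) (ρ n), fun n ↦ Metric.isOpen_ball,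
    fun n ↦ Metric.mem_ball_self (hρ0 n), fun n z hz ↦ ?_, fun n hx ↦ ?_, ?_, fun W hW ↦ ?_⟩
  · have hz := Metric.closure_ball_subset_closedBall hz
    refine ⟨hεV (Metric.mem_ball.2 ?_), hρG n hz⟩
    linarith [hhigh hz, hd_le n]
  · have := hlow (Metric.closure_ball_subset_closedBall hx)
    rw [dist_self] at this
    linarith [hd0 n]
  · refine (pairwise_disjoint_on _).2 fun m n hmn ↦ disjoint_left.2 fun z hm hn ↦ ?_
    have h1 := hlow (Metric.ball_subset_closedBall hm)
    have h2 := hhigh (Metric.ball_subset_closedBall hn)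
    have h3 := hd_anti.antitone (Nat.succ_le_of_lt hmn)
    have h4 := hd_succ m
    rw [Nat.succ_eq_add_one] at h3
    linarith [hd0 m]
  · obtain ⟨δ, hδ, hδW⟩ := Metric.mem_nhds_iff.1 hW
    filter_upwards [hd_tendsto.eventually_lt_const (half_pos hδ)] with n hn z hz
    refine hδW (Metric.mem_ball.2 ?_)
    linarith [hhigh (Metric.ball_subset_closedBall hz)]

lemma exists_isClosedEmbedding_rat_of_not_baireSpace [MetricSpace X] (hX : ¬ BaireSpace X) :
    ∃ f : ℚ → X, IsClosedEmbedding f := by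
  obtain ⟨G, hGo, hGd, hG⟩ : ∃ G : ℕ → Set X,
      (∀ n, IsOpen (G n)) ∧ (∀ n, Dense (G n)) ∧ ¬ Dense (⋂ n, G n) := by
    contrapose! hX
    exact ⟨fun G hGo hGd ↦ hX G hGo hGd⟩
  rw [dense_iff_inter_open] at hG
  push Not at hG
  obtain ⟨O, hO, ⟨x₀, hx₀⟩, hOG⟩ := hG
  have hmeager (p) (hp : p ∈ O) : ∃ n, p ∉ G n := by
    by_contra! h
    exact eq_empty_iff_forall_notMem.1 hOG p ⟨hp, mem_iInter.2 h⟩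
  have hneBot (p) (hp : p ∈ O) : (𝓝[≠] p).NeBot := by
    refine ⟨fun h ↦ ?_⟩
    obtain ⟨n, hn⟩ := hmeager p hp
    obtain ⟨z, rfl, hz⟩ := (hGd n).inter_open_nonempty {p}
      ((isOpen_singleton_iff_punctured_nhds p).2 h) ⟨p, rfl⟩
    exact hn hz
  let State := {σ : ℕ × X × Set X // IsOpen σ.2.2 ∧ σ.2.1 ∈ σ.2.2 ∧ σ.2.2 ⊆ O}
  have hstep (σ : State) : ∃ τ : ℕ → State, (∀ n, (τ n).1.1 = σ.1.1 + 1) ∧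
      (∀ n, closure (τ n).1.2.2 ⊆ σ.1.2.2 ∩ G σ.1.1) ∧
      (∀ n, σ.1.2.1 ∉ closure (τ n).1.2.2) ∧
      (Pairwise fun m n ↦ Disjoint (τ m).1.2.2 (τ n).1.2.2) ∧
      ∀ W ∈ 𝓝 σ.1.2.1, ∀ᶠ n in atTop, (τ n).1.2.2 ⊆ W := by
    obtain ⟨⟨k, x, V⟩, hVo, hxV, hVO⟩ := σ
    have := hneBot x (hVO hxV)
    obtain ⟨y, U, hUo, hyU, hUV, hxU, hU, hconv⟩ :=
      exists_seq_converging_open_sets (hVo.mem_nhds hxV) (hGo k) (hGd k)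
    exact ⟨fun n ↦ ⟨(k + 1, y n, U n), hUo n, hyU n,
      subset_closure.trans ((hUV n).trans (inter_subset_left.trans hVO))⟩,
      fun _ ↦ rfl, hUV, hxU, hU, hconv⟩
  choose τ hτk hτV hτx hτd hτc using hstep
  obtain ⟨V₀, hV₀, hV₀c, hV₀O⟩ := exists_mem_nhds_isClosed_subset (hO.mem_nhds hx₀)
  let σ₀ : State := ⟨(0, x₀, interior V₀), isOpen_interior, mem_interior_iff_mem_nhds.2 hV₀,
    interior_subset.trans hV₀O⟩
  let σ (s : List ℕ) : State := s.foldl τ σ₀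
  have hσ (s n) : σ (s ++ [n]) = τ (σ s) n := by simp [σ]
  have hσk (s) : (σ s).1.1 = s.length := by
    induction s using List.reverseRecOn with
    | nil => rfl
    | append_singleton s n ih => simp [hσ, hτk, ih]
  have hscheme : IsTreeScheme (fun s ↦ (σ s).1.2.1) (fun s ↦ (σ s).1.2.2) :=
  { isOpen := fun s ↦ (σ s).2.1
    mem := fun s ↦ (σ s).2.2.1
    closure_subset := fun s n ↦ by simpa only [hσ] using (hτV (σ s) n).trans inter_subset_left
    notMem := fun s n ↦ by simpa only [hσ] using hτx (σ s) n
    disjoint := fun s ↦ by simpa only [hσ] using hτd (σ s)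
    eventually_subset := fun s V hV ↦ by simpa only [hσ] using hτc (σ s) V hV }
  refine hscheme.exists_isClosedEmbedding_rat fun p ↦ ?_
  by_cases hp : p ∈ O
  · obtain ⟨k, hk⟩ := hmeager p hp
    refine ⟨k + 1, fun s hs hps ↦ ?_⟩
    obtain rfl | ⟨s, n, rfl⟩ := s.eq_nil_or_concat'
    · simp at hs
    · simp only [hσ] at hps
      have := (hτV (σ s) n hps).2
      rw [hσk, show s.length = k by simpa using hs] at this
      exact hk this
  · refine ⟨0, fun s hs hps ↦ hp ?_⟩
    obtain rfl := List.length_eq_zero_iff.1 hs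
    exact hV₀O (closure_minimal interior_subset hV₀c hps)

lemma not_baireSpace_rat : ¬ BaireSpace ℚ := fun _ ↦ by
  have h := dense_iInter_of_isOpen (f := fun q : ℚ ↦ {q}ᶜ) (fun _ ↦ isOpen_compl_singleton)
    fun q ↦ dense_compl_singleton q
  obtain ⟨q, hq⟩ := h.nonempty
  exact mem_iInter.1 hq q rfl

end Hurewicz

/-- Hurewicz's theorem: a separable metrizable space is hereditarily Baire iff
`ℚ` does not embed into it as a closed subspace. -/
theorem hereditarilyBaire_iff_no_closed_copy_of_rat {X : Type*} [TopologicalSpace X]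
    [TopologicalSpace.SeparableSpace X] [TopologicalSpace.MetrizableSpace X] :
    HereditarilyBaire X ↔ ¬ ∃ f : ℚ → X, Topology.IsClosedEmbedding f := by
  refine ⟨?_, fun h C hC ↦ ?_⟩
  · rintro h ⟨f, hf⟩
    have := h _ hf.isClosed_range
    exact Hurewicz.not_baireSpace_rat hf.isEmbedding.toHomeomorph.symm.baireSpace
  · by_contra hCB
    let := TopologicalSpace.metrizableSpaceMetric C
    obtain ⟨f, hf⟩ := Hurewicz.exists_isClosedEmbedding_rat_of_not_baireSpace hCB
    exact h ⟨_, hC.isClosedEmbedding_subtypeVal.comp hf⟩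
end

section
/- Let X be a subspace of a compact Hausdorff space Z. Then Z∖X is Menger if and only if K(Z)∖K(X) is Menger, where K(Z) is the Vietoris hyperspace of Z and K(X) ⊆ K(Z) is the set of nonempty compact subsets of X. -/
/-- The hyperspace of nonempty compact subsets of a topological space. -/
def Hyper (X : Type*) [TopologicalSpace X] : Type _ :=
  {K : Set X // IsCompact K ∧ K.Nonempty}

/-- The Vietoris topology on the hyperspace, generated by the sets
`{K : K ⊆ U}` and `{K : K ∩ U ≠ ∅}` for `U` open. -/
instance Hyper.instTopologicalSpace (X : Type*) [TopologicalSpace X] :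
    TopologicalSpace (Hyper X) :=
  TopologicalSpace.generateFrom
    ({s | ∃ U : Set X, IsOpen U ∧ s = {K : Hyper X | K.1 ⊆ U}} ∪
     {s | ∃ U : Set X, IsOpen U ∧ s = {K : Hyper X | (K.1 ∩ U).Nonempty}})

/-- A space is Menger if for every sequence of open covers there are finite
subfamilies whose union is a cover. -/
def Menger (X : Type*) [TopologicalSpace X] : Prop :=
  ∀ U : ℕ → Set (Set X),
    (∀ n, (∀ u ∈ U n, IsOpen u) ∧ ⋃₀ (U n) = Set.univ) →
    ∃ V : ℕ → Set (Set X),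
      (∀ n, V n ⊆ U n ∧ (V n).Finite) ∧ ⋃₀ (⋃ n, V n) = Set.univ

namespace Menger

variable {A B : Type*} [TopologicalSpace A] [TopologicalSpace B]

/-- The selection property of a Menger space, for covers indexed by sets of a fixed type. -/
theorem exists_finite_selection {ι : Type*} (hA : Menger A) (I : ℕ → Set ι) (f : ι → Set A)
    (hopen : ∀ n, ∀ i ∈ I n, IsOpen (f i)) (hcover : ∀ n a, ∃ i ∈ I n, a ∈ f i) :
    ∃ F : ℕ → Set ι, (∀ n, F n ⊆ I n ∧ (F n).Finite) ∧ ∀ a, ∃ n, ∃ i ∈ F n, a ∈ f i := by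
  obtain ⟨V, hV, hVcover⟩ := hA (fun n => f '' I n) fun n =>
    ⟨Set.forall_mem_image.2 (hopen n), Set.eq_univ_of_forall fun a => by
      simpa using hcover n a⟩
  have hpre (n : ℕ) : ∃ F ⊆ I n, F.Finite ∧ V n = f '' F := by
    exact Set.exists_subset_image_finite_and.1 ⟨V n, (hV n).1, (hV n).2, rfl⟩
  choose F hFI hFfin hFV using hpre
  refine ⟨F, fun n => ⟨hFI n, hFfin n⟩, fun a => ?_⟩
  obtain ⟨v, hv, hav⟩ := Set.eq_univ_iff_forall.1 hVcover a
  obtain ⟨n, hn⟩ := Set.mem_iUnion.1 hv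
  rw [hFV n] at hn
  obtain ⟨i, hi, rfl⟩ := hn
  exact ⟨n, i, hi, hav⟩

/-- The Menger property is inherited by the union of the values of a compact-valued upper
semicontinuous set-valued map. -/
theorem of_compact_valued (hA : Menger A) (C : A → Set B) (hC : ∀ a, IsCompact (C a))
    (husc : ∀ W, IsOpen W → IsOpen {a | C a ⊆ W}) (hcover : ∀ b, ∃ a, b ∈ C a) : Menger B := by
  intro U hU
  obtain ⟨F, hF, hFcover⟩ := hA.exists_finite_selection
    (fun n => {s : Set (Set B) | s ⊆ U n ∧ s.Finite}) (fun s => {a | C a ⊆ ⋃₀ s})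
    (fun n s hs => husc _ (isOpen_sUnion fun u hu => (hU n).1 u (hs.1 hu)))
    (fun n a => by
      obtain ⟨s, hsU, hs, hCs⟩ := (hC a).elim_finite_subcover_image (c := id) (hU n).1
        (by simp [← Set.sUnion_eq_biUnion, (hU n).2])
      exact ⟨s, ⟨hsU, hs⟩, by rwa [Set.sUnion_eq_biUnion]⟩)
  refine ⟨fun n => ⋃₀ F n, fun n => ⟨Set.sUnion_subset fun s hs => ((hF n).1 hs).1,
    (hF n).2.sUnion fun s hs => ((hF n).1 hs).2⟩, Set.eq_univ_of_forall fun b => ?_⟩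
  obtain ⟨a, hba⟩ := hcover b
  obtain ⟨n, s, hs, has⟩ := hFcover a
  obtain ⟨u, hu, hbu⟩ := has hba
  exact ⟨u, Set.mem_iUnion.2 ⟨n, s, hs, hu⟩, hbu⟩

end Menger

namespace Hyper

variable {Z : Type*} [TopologicalSpace Z]

theorem isOpen_setOf_subset {U : Set Z} (hU : IsOpen U) : IsOpen {K : Hyper Z | K.1 ⊆ U} :=
  TopologicalSpace.isOpen_generateFrom_of_mem (.inl ⟨U, hU, rfl⟩)

theorem isOpen_setOf_inter_nonempty {U : Set Z} (hU : IsOpen U) :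
    IsOpen {K : Hyper Z | (K.1 ∩ U).Nonempty} :=
  TopologicalSpace.isOpen_generateFrom_of_mem (.inr ⟨U, hU, rfl⟩)

instance [CompactSpace Z] : CompactSpace (Hyper Z) := by
  let f : TopologicalSpace.NonemptyCompacts Z → Hyper Z :=
    fun K => ⟨K, K.isCompact, K.nonempty⟩
  have hf : Continuous f := by
    refine continuous_generateFrom_iff.2 ?_
    rintro _ (⟨U, hU, rfl⟩ | ⟨U, hU, rfl⟩)
    · exact TopologicalSpace.NonemptyCompacts.isOpen_subsets_of_isOpen hU
    · exact TopologicalSpace.NonemptyCompacts.isOpen_inter_nonempty_of_isOpen hU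
  have hsurj : Function.Surjective f := fun K => ⟨⟨⟨K.1, K.2.1⟩, K.2.2⟩, rfl⟩
  exact hsurj.compactSpace hf

theorem isClosed_setOf_mem [T2Space Z] : IsClosed {p : Z × Hyper Z | p.1 ∈ p.2.1} := by
  rw [← isOpen_compl_iff, isOpen_iff_mem_nhds]
  rintro ⟨z, K⟩ (hz : z ∉ K.1)
  obtain ⟨U, V, hU, hV, hzU, hKV, hUV⟩ :=
    SeparatedNhds.of_isCompact_isCompact (isCompact_singleton (x := z)) K.2.1
      (Set.disjoint_singleton_left.2 hz)
  filter_upwards [prod_mem_nhds (hU.mem_nhds (hzU rfl)) ((isOpen_setOf_subset hV).mem_nhds hKV)]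
    with p hp hmem
  exact Set.disjoint_left.1 hUV hp.1 (hp.2 hmem)

theorem isClosed_setOf_mem_right [T2Space Z] (z : Z) : IsClosed {K : Hyper Z | z ∈ K.1} :=
  isClosed_setOf_mem.preimage (Continuous.prodMk_right z)

/-- The set-valued map sending a point to the family of compact sets containing it is upper
semicontinuous. -/
theorem isOpen_setOf_forall_mem [CompactSpace Z] [T2Space Z] {W : Set (Hyper Z)}
    (hW : IsOpen W) : IsOpen {z : Z | ∀ K : Hyper Z, z ∈ K.1 → K ∈ W} := by
  have hclosed := isClosedMap_fst_of_compactSpace _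
    (isClosed_setOf_mem.inter (hW.isClosed_compl.preimage (continuous_snd (X := Z))))
  convert hclosed.isOpen_compl using 1
  ext z
  simp

end Hyper

theorem Menger.hyperspace_remainder {Z : Type*} [TopologicalSpace Z] [CompactSpace Z] [T2Space Z] {X : Set Z} (h : Menger ↥Xᶜ) :
    Menger ↥({K : Hyper Z | K.1 ⊆ X}ᶜ) := by
  refine h.of_compact_valued (fun z => {K | z.1 ∈ K.1.1}) (fun z => ?_) (fun W hW => ?_) ?_
  · rw [Topology.IsEmbedding.subtypeVal.isCompact_iff]
    convert (Hyper.isClosed_setOf_mem_right z.1).isCompact using 1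
    ext K
    simp only [Set.mem_image, Set.mem_ofPred_eq]
    exact ⟨by rintro ⟨K, hK, rfl⟩; exact hK, fun hK => ⟨⟨K, fun hKX => z.2 (hKX hK)⟩, hK, rfl⟩⟩
  · obtain ⟨W', hW', rfl⟩ := isOpen_induced_iff.1 hW
    convert (Hyper.isOpen_setOf_forall_mem hW').preimage continuous_subtype_val using 1
    ext z
    exact ⟨fun hz K hK => hz (a := ⟨K, fun hKX => z.2 (hKX hK)⟩) hK, fun hz K hK => hz K.1 hK⟩
  · rintro ⟨K, hK⟩
    obtain ⟨z, hzK, hzX⟩ := Set.not_subset.1 hK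
    exact ⟨⟨z, hzX⟩, hzK⟩

theorem Menger.of_hyperspace_remainder {Z : Type*} [TopologicalSpace Z] {X : Set Z}
    (h : Menger ↥({K : Hyper Z | K.1 ⊆ X}ᶜ)) : Menger ↥Xᶜ := by
  intro U hU
  obtain ⟨F, hF, hFcover⟩ := h.exists_finite_selection U
    (fun u => {K | (K.1.1 ∩ interior (Subtype.val '' u ∪ X)).Nonempty})
    (fun n u _ => (Hyper.isOpen_setOf_inter_nonempty isOpen_interior).preimage
      continuous_subtype_val)
    (fun n K => by
      obtain ⟨z, hzK, hzX⟩ := Set.not_subset.1 K.2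
      obtain ⟨u, hu, hzu⟩ := Set.eq_univ_iff_forall.1 (hU n).2 ⟨z, hzX⟩
      obtain ⟨O, hO, rfl⟩ := isOpen_induced_iff.1 ((hU n).1 u hu)
      refine ⟨_, hu, z, hzK, interior_maximal (fun y hy => ?_) hO hzu⟩
      by_cases hyX : y ∈ X
      · exact .inr hyX
      · exact .inl ⟨⟨y, hyX⟩, hy, rfl⟩)
  refine ⟨F, hF, Set.eq_univ_of_forall fun z => ?_⟩
  obtain ⟨n, u, hu, y, hyz, hy⟩ := hFcover
    ⟨⟨{z.1}, isCompact_singleton, Set.singleton_nonempty _⟩, fun hz => z.2 (hz rfl)⟩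
  obtain rfl : y = z.1 := hyz
  refine ⟨u, Set.mem_iUnion.2 ⟨n, hu⟩, ?_⟩
  obtain ⟨w, hw, hwz⟩ | hzX := interior_subset hy
  · rwa [← Subtype.ext hwz]
  · exact absurd hzX z.2

/-- For a subspace `X` of a compact Hausdorff space `Z`, the remainder `Z \ X`
is Menger iff `K(Z) \ K(X)` is Menger, where `K(Z)` carries the Vietoris
topology and `K(X) = {K ∈ K(Z) : K ⊆ X}`. -/
theorem menger_remainder_iff_menger_hyperspace_remainder {Z : Type*}
    [TopologicalSpace Z] [CompactSpace Z] [T2Space Z] (X : Set Z) :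
    Menger ↥Xᶜ ↔ Menger ↥({K : Hyper Z | K.1 ⊆ X}ᶜ) := by
  exact ⟨Menger.hyperspace_remainder, Menger.of_hyperspace_remainder⟩
end

section
/- If X is a separable metrizable space contained in a compact metrizable space Z such that Z∖X is Menger, then the hyperspace K(X) with the Vietoris topology is hereditarily Baire. -/
open Set Filter Topology TopologicalSpace Metric

/-- In a Menger space, given open covers `k ↦ V n k` that increase with `k`, one can choose a single
member of each so that the chosen sets cover the space. -/
theorem Menger.exists_seq_iUnion_eq_univ {Y : Type*} [TopologicalSpace Y] (h : Menger Y)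
    (V : ℕ → ℕ → Set Y) (hopen : ∀ n k, IsOpen (V n k)) (hmono : ∀ n, Monotone (V n))
    (hcover : ∀ n y, ∃ k, y ∈ V n k) : ∃ f : ℕ → ℕ, ∀ y, ∃ n, y ∈ V n (f n) := by
  obtain ⟨F, hF, hFcover⟩ := h (fun n ↦ range (V n)) fun n ↦ by
    refine ⟨?_, eq_univ_of_forall fun y ↦ ?_⟩
    · rintro _ ⟨k, rfl⟩
      exact hopen n k
    · obtain ⟨k, hk⟩ := hcover n y
      exact ⟨_, mem_range_self k, hk⟩
  have hbound (n : ℕ) : ∃ m, ∀ v ∈ F n, v ⊆ V n m := by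
    obtain ⟨m, hm⟩ := ((hF n).2.image (Function.invFun (V n))).bddAbove
    refine ⟨m, fun v hv ↦ ?_⟩
    have hv_eq := Function.invFun_eq (mem_range.1 ((hF n).1 hv))
    exact hv_eq ▸ hmono n (hm (mem_image_of_mem _ hv))
  choose f hf using hbound
  refine ⟨f, fun y ↦ ?_⟩
  obtain ⟨v, hv, hyv⟩ := hFcover.ge (mem_univ y)
  obtain ⟨n, hn⟩ := mem_iUnion.1 hv
  exact ⟨n, hf n v hn hyv⟩

/-- Given a game with positions `σ`, each carrying a set `U σ` that can only grow during the play,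
if from each position some move captures a neighbourhood of `y`, then for each `n` there is a move
which, played at stage `n`, captures a fixed neighbourhood of `y` whatever the first `n` moves. -/
theorem exists_move_eventually_mem {Y S : Type*} [TopologicalSpace Y] (step : S → ℕ → S)
    (U : S → Set Y) (hmono : ∀ s, Monotone fun k ↦ U (step s k))
    (hstep : ∀ s k, U s ⊆ U (step s k)) (hcover : ∀ s y, ∃ k, U (step s k) ∈ 𝓝 y)
    (y : Y) (n : ℕ) (s : S) :
    ∃ k, ∀ᶠ z in 𝓝 y, ∀ l : List ℕ, l.length = n → z ∈ U (step (l.foldl step s) k) := by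
  induction n generalizing s with
  | zero =>
    obtain ⟨k, hk⟩ := hcover s y
    refine ⟨k, mem_of_superset hk fun z hz l hl ↦ ?_⟩
    rwa [List.length_eq_zero_iff.1 hl]
  | succ n ih =>
    obtain ⟨j, hj⟩ := hcover s y
    choose m hm using fun i ↦ ih (step s i)
    refine ⟨(Finset.range j).sup m, ?_⟩
    have hsmall : ∀ᶠ z in 𝓝 y, ∀ i ∈ Finset.range j, ∀ l : List ℕ, l.length = n →
        z ∈ U (step (l.foldl step (step s i)) (m i)) :=
      (eventually_all_finset _).2 fun i _ ↦ hm i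
    have hfoldl (l : List ℕ) (t : S) : U t ⊆ U (l.foldl step t) := by
      induction l generalizing t with
      | nil => exact Subset.rfl
      | cons i l ihl => exact (hstep t i).trans (ihl _)
    filter_upwards [hj, hsmall] with z hz hzsmall l hl
    cases l with
    | nil => simp at hl
    | cons i l =>
      rw [List.foldl_cons]
      by_cases hi : i < j
      · exact hmono _ (Finset.le_sup (f := m) (Finset.mem_range.2 hi))
          (hzsmall i (Finset.mem_range.2 hi) l (by simpa using hl))
      · exact hstep _ _ (hfoldl l _ (hmono s (not_lt.1 hi) hz))

/-- Hurewicz's theorem: in a Menger space the first player has no winning strategy in the Menger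
game. The strategy is presented by positions `S` and increasing covers `k ↦ U (step s k)`. -/
theorem Menger.exists_play {Y S : Type*} [TopologicalSpace Y] (h : Menger Y) (step : S → ℕ → S)
    (U : S → Set Y) (hmono : ∀ s, Monotone fun k ↦ U (step s k))
    (hstep : ∀ s k, U s ⊆ U (step s k)) (hcover : ∀ s y, ∃ k, U (step s k) ∈ 𝓝 y) (s₀ : S) :
    ∃ p : ℕ → S, p 0 = s₀ ∧ (∀ n, ∃ k, p (n + 1) = step (p n) k) ∧ ∀ y, ∃ n, y ∈ U (p n) := by
  obtain ⟨f, hf⟩ := h.exists_seq_iUnion_eq_univ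
    (fun n k ↦ interior {z | ∀ l : List ℕ, l.length = n → z ∈ U (step (l.foldl step s₀) k)})
    (fun _ _ ↦ isOpen_interior)
    (fun n a b hab ↦ interior_mono fun z hz l hl ↦ hmono _ hab (hz l hl))
    (fun n y ↦ by
      obtain ⟨k, hk⟩ := exists_move_eventually_mem step U hmono hstep hcover y n s₀
      exact ⟨k, mem_interior_iff_mem_nhds.2 hk⟩)
  have hsucc (n : ℕ) : ((List.range (n + 1)).map f).foldl step s₀ =
      step (((List.range n).map f).foldl step s₀) (f n) := by
    simp [List.range_succ]
  refine ⟨fun n ↦ ((List.range n).map f).foldl step s₀, rfl, fun n ↦ ⟨f n, hsucc n⟩, fun y ↦ ?_⟩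
  obtain ⟨n, hn⟩ := hf y
  refine ⟨n + 1, ?_⟩
  beta_reduce
  rw [hsucc]
  exact interior_subset hn _ (by simp)

/-- If the complement of `X` is Menger, then a space of compact subsets of `X` that contains all its
limits that are contained in `X` is a Baire space. -/
theorem Menger.baireSpace_of_isInducing {Z C : Type*} [MetricSpace Z] [CompactSpace Z]
    [TopologicalSpace C] {X : Set Z} (h : Menger ↥Xᶜ) {g : C → NonemptyCompacts Z}
    (hg : IsInducing g) (hgX : ∀ c, (g c : Set Z) ⊆ X)
    (hclosed : ∀ L ∈ closure (range g), (L : Set Z) ⊆ X → L ∈ range g) : BaireSpace C := by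
  refine ⟨fun O hO hdense ↦ dense_iff_inter_open.2 fun W hW ⟨c₀, hc₀⟩ ↦ ?_⟩
  have hball {V : Set C} (hV : IsOpen V) {c : C} (hc : c ∈ V) :
      ∃ ε > 0, ∀ d, dist (g d) (g c) ≤ ε → d ∈ V := by
    obtain ⟨ε, hε, hεV⟩ := (hg.basis_nhds nhds_basis_closedBall).mem_iff.1 (hV.mem_nhds hc)
    exact ⟨ε, hε, fun d hd ↦ hεV hd⟩
  have hnext (n : ℕ) (c : C) (ε : Ioi (0 : ℝ)) : ∃ (c' : C) (δ : Ioi (0 : ℝ)),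
      (δ : ℝ) ≤ ε / 2 ∧ dist (g c) (g c') ≤ ε / 2 ∧ ∀ d, dist (g d) (g c') ≤ δ → d ∈ O n := by
    obtain ⟨ε, hε⟩ := ε
    have hε2 : 0 < ε / 2 := half_pos hε
    obtain ⟨c', hc'ball, hc'O⟩ := (hdense n).inter_open_nonempty _
      (isOpen_ball.preimage hg.continuous) ⟨c, mem_ball_self (x := g c) hε2⟩
    obtain ⟨δ, hδ, hδO⟩ := hball (hO n) hc'O
    exact ⟨c', ⟨min δ (ε / 2), lt_min hδ hε2⟩, min_le_right _ _, (mem_ball'.1 hc'ball).le,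
      fun d hd ↦ hδO d (hd.trans (min_le_left _ _))⟩
  choose c' δ hδ hc' hδO using hnext
  obtain ⟨ε₀, hε₀, hε₀W⟩ := hball hW hc₀
  have hinf (z : Z) (K L : NonemptyCompacts Z) : infDist z K ≤ infDist z L + dist K L := by
    have := (lipschitz_infDist_set z).dist_le_mul K L
    rw [Real.dist_eq, NNReal.coe_one, one_mul] at this
    linarith [le_abs_self (infDist z K - infDist z L)]
  -- a position is the number of moves made, a compact set, and a radius around it
  obtain ⟨p, hp₀, hp, hpcover⟩ := h.exists_play (S := ℕ × C × Ioi (0 : ℝ))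
    (fun s k ↦ (s.1 + 1, c' s.1 s.2.1 s.2.2,
      ⟨min (δ s.1 s.2.1 s.2.2 : ℝ) (1 / ((k : ℝ) + 1)),
        mem_Ioi.2 (lt_min (δ s.1 s.2.1 s.2.2).2 Nat.one_div_pos_of_nat)⟩))
    (fun s ↦ {y | (s.2.2 : ℝ) < infDist (y : Z) (g s.2.1)})
    (fun s a b hab y hy ↦ by
      have hle : min (δ s.1 s.2.1 s.2.2 : ℝ) (1 / ((b : ℝ) + 1)) ≤
          min (δ s.1 s.2.1 s.2.2 : ℝ) (1 / ((a : ℝ) + 1)) :=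
        min_le_min_left _ (Nat.one_div_le_one_div hab)
      exact hle.trans_lt hy)
    (fun s k y hy ↦ by
      have hy' : (s.2.2 : ℝ) < infDist (y : Z) (g s.2.1) := hy
      have : (δ s.1 s.2.1 s.2.2 : ℝ) < infDist (y : Z) (g (c' s.1 s.2.1 s.2.2)) := by
        linarith [hinf y (g s.2.1) (g (c' s.1 s.2.1 s.2.2)), hδ s.1 s.2.1 s.2.2,
          hc' s.1 s.2.1 s.2.2]
      exact (min_le_left _ _).trans_lt this)
    (fun s y ↦ by
      set K := g (c' s.1 s.2.1 s.2.2)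
      have hpos : 0 < infDist (y : Z) K :=
        (K.isCompact.isClosed.notMem_iff_infDist_pos K.nonempty).1 fun hy ↦ y.2 (hgX _ hy)
      obtain ⟨k, hk⟩ := exists_nat_one_div_lt hpos
      refine ⟨k, IsOpen.mem_nhds ?_ ((min_le_right _ _).trans_lt hk)⟩
      exact isOpen_lt continuous_const
        ((continuous_infDist_pt (K : Set Z)).comp continuous_subtype_val))
    (0, c₀, ⟨ε₀, hε₀⟩)
  set ε : ℕ → ℝ := fun n ↦ (p n).2.2
  set K : ℕ → NonemptyCompacts Z := fun n ↦ g (p n).2.1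
  have hfst (n : ℕ) : (p n).1 = n := by
    induction n with
    | zero => rw [hp₀]
    | succ n ih =>
      obtain ⟨k, hk⟩ := hp n
      rw [hk, ih]
  have hεpos (n : ℕ) : 0 < ε n := (p n).2.2.2
  have hεsucc (n : ℕ) : ε (n + 1) ≤ ε n / 2 := by
    obtain ⟨k, hk⟩ := hp n
    simp only [ε, hk]
    exact (min_le_left _ _).trans (hδ _ _ _)
  have hKsucc (n : ℕ) : dist (K n) (K (n + 1)) ≤ ε n / 2 := by
    obtain ⟨k, hk⟩ := hp n
    simp only [K, hk]
    exact hc' _ _ _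
  have hOsucc (n : ℕ) (d : C) (hd : dist (g d) (K (n + 1)) ≤ ε (n + 1)) : d ∈ O n := by
    obtain ⟨k, hk⟩ := hp n
    simp only [K, ε, hk] at hd
    have := hδO _ _ _ d (hd.trans (min_le_left _ _))
    rwa [hfst] at this
  have hεtendsto : Tendsto ε atTop (𝓝 0) := by
    have hle (n : ℕ) : ε n ≤ ε 0 * (1 / 2) ^ n := by
      induction n with
      | zero => simp
      | succ n ih => rw [pow_succ]; linarith [hεsucc n]
    refine squeeze_zero (fun n ↦ (hεpos n).le) hle ?_
    simpa using (tendsto_pow_atTop_nhds_zero_of_lt_one (r := (1 / 2 : ℝ)) (by norm_num)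
      (by norm_num)).const_mul (ε 0)
  have hKnear (n m : ℕ) : dist (K (n + m)) (K n) ≤ ε n - ε (n + m) := by
    induction m with
    | zero => simp
    | succ m ih =>
      have := dist_triangle_left (K (n + (m + 1))) (K n) (K (n + m))
      have h₁ := hKsucc (n + m)
      have h₂ := hεsucc (n + m)
      rw [← add_assoc] at this ⊢
      linarith
  have hKε (n m : ℕ) (hnm : n ≤ m) : dist (K m) (K n) ≤ ε n := by
    obtain ⟨m, rfl⟩ := Nat.exists_eq_add_of_le hnm
    linarith [hKnear n m, hεpos (n + m)]
  obtain ⟨L, hL⟩ := cauchySeq_tendsto_of_complete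
    (cauchySeq_of_le_tendsto_0' ε (fun n m hnm ↦ dist_comm (K m) (K n) ▸ hKε n m hnm) hεtendsto)
  have hLε (n : ℕ) : dist L (K n) ≤ ε n :=
    le_of_tendsto (hL.dist tendsto_const_nhds) ((eventually_ge_atTop n).mono fun m ↦ hKε n m)
  obtain ⟨d, rfl⟩ := hclosed L
    (mem_closure_of_tendsto hL (Eventually.of_forall fun n ↦ mem_range_self _)) fun z hz ↦ by
      by_contra hzX
      obtain ⟨n, hn⟩ := hpcover ⟨z, hzX⟩
      have hn' : ε n < infDist z (K n) := hn
      linarith [hinf z (K n) L, infDist_zero_of_mem hz, dist_comm L (K n), hLε n]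
  refine ⟨d, hε₀W d ?_, mem_iInter.2 fun n ↦ hOsucc n d (hLε (n + 1))⟩
  simpa [K, ε, hp₀] using hLε 0

/-- The Vietoris topology on `Hyper X` is induced from the one on the compact subsets of an ambient
space. -/
theorem Hyper.isInducing_image_val {Z : Type*} [TopologicalSpace Z] (X : Set Z) :
    IsInducing fun K : Hyper ↥X ↦ (⟨⟨Subtype.val '' K.1, K.2.1.image continuous_subtype_val⟩,
      K.2.2.image _⟩ : NonemptyCompacts Z) := by
  let _ := TopologicalSpace.vietoris Z
  let _ := TopologicalSpace.vietoris ↥X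
  have hcoe : IsInducing (fun K : Hyper ↥X ↦ K.1) := by
    refine ⟨?_⟩
    refine Eq.trans ?_ induced_generateFrom_eq.symm
    rw [Hyper.instTopologicalSpace, image_union,
      image_image, image_image]
    congr 1
    ext s
    simp only [mem_union, mem_image, mem_ofPred_eq, eq_comm (a := s)]
    rfl
  exact (NonemptyCompacts.isEmbedding_coe.isInducing.of_comp_iff).1
    (IsInducing.subtypeVal.image_vietoris.comp hcoe)

/-- If `X` is a subspace of a compact metrizable space `Z` (so `X` is separable
metrizable) and `Z \ X` is Menger, then the hyperspace `K(X)` with the Vietoris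
topology is hereditarily Baire. -/
theorem hyperspace_hereditarilyBaire_of_menger_remainder {Z : Type*}
    [TopologicalSpace Z] [CompactSpace Z] [TopologicalSpace.MetrizableSpace Z]
    (X : Set Z) (h : Menger ↥Xᶜ) :
    HereditarilyBaire (Hyper ↥X) := by
  let _ := metrizableSpaceMetric Z
  intro C hC
  have hind := Hyper.isInducing_image_val X
  refine h.baireSpace_of_isInducing (hind.comp IsInducing.subtypeVal) ?_ ?_
  · rintro c _ ⟨x, -, rfl⟩
    exact x.2
  · intro L hL hLX
    have himage : Subtype.val '' (Subtype.val ⁻¹' (L : Set Z) : Set ↥X) = L :=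
      Subtype.image_preimage_val .. |>.trans (inter_eq_right.2 hLX)
    have hcompact : IsCompact (Subtype.val ⁻¹' (L : Set Z) : Set ↥X) := by
      rw [Subtype.isCompact_iff, himage]
      exact L.isCompact
    have hnonempty : (Subtype.val ⁻¹' (L : Set Z) : Set ↥X).Nonempty := by
      rw [← image_nonempty, himage]
      exact L.nonempty
    let K : Hyper ↥X := ⟨_, hcompact, hnonempty⟩
    have hKL : (⟨⟨Subtype.val '' K.1, K.2.1.image continuous_subtype_val⟩,
        K.2.2.image _⟩ : NonemptyCompacts Z) = L := NonemptyCompacts.ext himage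
    refine ⟨⟨K, ?_⟩, hKL⟩
    rw [← hC.closure_eq, hind.closure_eq_preimage_closure_image, mem_preimage, hKL]
    rwa [range_comp, Subtype.range_coe] at hL
end

section
/- There exists a separable metrizable space X ⊆ [0,1] that is not Polish (not completely metrizable) such that the hyperspace K(X) with the Vietoris topology is hereditarily Baire. -/
open Filter Set Topology TopologicalSpace

/-- There is a well-ordered family of functions `ℕ → ℕ` that is unbounded modulo finite sets, in the
strong sense that every function bounds only an initial piece of it, and whose length `o` is so
short that all families of smaller length are bounded. -/
theorem exists_unbounded_scale :
    ∃ (o : Ordinal.{0}) (f : Ordinal.{0} → ℕ → ℕ),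
      (∀ i < o, ∀ F : Ordinal.{0} → ℕ → ℕ, ∃ g : ℕ → ℕ, ∀ j < i, F j ≤ᶠ[atTop] g) ∧
      ∀ g : ℕ → ℕ, ∃ i < o, ∀ j, i ≤ j → j < o → ¬ f j ≤ᶠ[atTop] g := by
  classical
  let P : Ordinal.{0} → Prop := fun o =>
    ∃ F : Ordinal.{0} → ℕ → ℕ, ∀ g : ℕ → ℕ, ∃ i < o, ¬ F i ≤ᶠ[atTop] g
  have hP : ∃ o, P o := by
    let r : (ℕ → ℕ) → (ℕ → ℕ) → Prop := WellOrderingRel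
    refine ⟨Ordinal.type r, Function.invFun (Ordinal.typein r), fun g => ?_⟩
    refine ⟨Ordinal.typein r (g + 1), Ordinal.typein_lt_type r _, ?_⟩
    rw [Function.leftInverse_invFun (Ordinal.typein_injective r)]
    intro h
    obtain ⟨n, hn⟩ := h.exists
    simp at hn
  obtain ⟨o, ⟨F, hF⟩, hmin⟩ := WellFounded.has_min (Ordinal.lt_wf) {o | P o} hP
  have hbound : ∀ i < o, ∀ F : Ordinal.{0} → ℕ → ℕ, ∃ g : ℕ → ℕ, ∀ j < i, F j ≤ᶠ[atTop] g := by
    intro i hi F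
    by_contra! h
    exact hmin i ⟨F, h⟩ hi
  have hbound' : ∀ (i : Ordinal.{0}) (F : Ordinal.{0} → ℕ → ℕ),
      ∃ g : ℕ → ℕ, i < o → ∀ j < i, F j ≤ᶠ[atTop] g := by
    intro i F
    by_cases hi : i < o
    · obtain ⟨g, hg⟩ := hbound i hi F
      exact ⟨g, fun _ => hg⟩
    · exact ⟨0, fun h => absurd h hi⟩
  choose b hb using hbound'
  let step : ∀ i : Ordinal.{0}, (∀ j, j < i → ℕ → ℕ) → ℕ → ℕ := fun i rec n =>
    max (F i n) (b i (fun j => if h : j < i then rec j h else 0) n)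
  let f : Ordinal.{0} → ℕ → ℕ := Ordinal.lt_wf.fix step
  have hf : ∀ i, f i = step i (fun j _ => f j) := fun i => Ordinal.lt_wf.fix_eq step i
  have hFf : ∀ i n, F i n ≤ f i n := by
    intro i n
    rw [hf]
    exact le_max_left _ _
  have hff : ∀ i < o, ∀ j < i, f j ≤ᶠ[atTop] f i := by
    intro i hi j hj
    filter_upwards [hb i (fun j => if j < i then f j else 0) hi j hj] with n hn
    rw [hf i]
    refine le_trans ?_ (le_max_right _ _)
    simpa [hj] using hn
  refine ⟨o, f, hbound, fun g => ?_⟩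
  obtain ⟨i, hi, hig⟩ := hF g
  refine ⟨i, hi, fun j hij hj h => hig ?_⟩
  have hij' : f i ≤ᶠ[atTop] f j := by
    rcases hij.eq_or_lt with rfl | hlt
    · exact EventuallyLE.refl _ _
    · exact hff j hj i hlt
  exact (show F i ≤ᶠ[atTop] f i from .of_forall (hFf i)).trans (hij'.trans h)

/-- The characteristic function of the set of partial sums of the sequence `f + 1`. -/
noncomputable def partialSumsIndicator (f : ℕ → ℕ) : ℕ → Bool := by
  classical
  exact fun m => decide (∃ n, ∑ k ∈ Finset.range (n + 1), (f k + 1) = m)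

theorem partialSumsIndicator_eq_true {f : ℕ → ℕ} {m : ℕ} :
    partialSumsIndicator f m = true ↔ ∃ n, ∑ k ∈ Finset.range (n + 1), (f k + 1) = m := by
  simp [partialSumsIndicator]

theorem strictMono_sum_range_succ (f : ℕ → ℕ) :
    StrictMono fun n => ∑ k ∈ Finset.range (n + 1), (f k + 1) :=
  strictMono_nat_of_lt_succ fun n => by
    rw [Finset.sum_range_succ _ (n + 1)]
    omega

/-- The characteristic functions of the finite subsets of `ℕ`. -/
def finiteIndicators : Set (ℕ → Bool) :=
  range fun (s : Finset ℕ) n => decide (n ∈ s)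

theorem countable_finiteIndicators : finiteIndicators.Countable := countable_range _

theorem notMem_finiteIndicators_iff {x : ℕ → Bool} :
    x ∉ finiteIndicators ↔ ∀ n, ∃ m ≥ n, x m = true := by
  constructor
  · intro hx n
    by_contra! h
    refine hx ⟨(Finset.range n).filter (x · = true), funext fun m => ?_⟩
    by_cases hm : m < n
    · simp [hm]
    · simp [hm, h m (not_lt.1 hm)]
  · rintro h ⟨s, rfl⟩
    obtain ⟨m, hm, hms⟩ := h (s.sup id + 1)
    have := Finset.le_sup (f := id) (of_decide_eq_true hms)
    simp only [id] at this
    omega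

theorem partialSumsIndicator_notMem_finiteIndicators (f : ℕ → ℕ) :
    partialSumsIndicator f ∉ finiteIndicators :=
  notMem_finiteIndicators_iff.2 fun n =>
    ⟨_, (Nat.le_succ n).trans ((strictMono_sum_range_succ f).le_apply (x := n + 1)),
      partialSumsIndicator_eq_true.2 ⟨n + 1, rfl⟩⟩

theorem IsCompact.exists_bound_of_disjoint_finiteIndicators {K : Set (ℕ → Bool)} (hK : IsCompact K)
    (hd : Disjoint K finiteIndicators) :
    ∃ g : ℕ → ℕ, ∀ f, partialSumsIndicator f ∈ K → ∀ n, f n ≤ g n := by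
  have hgap : ∀ n, ∃ b, ∀ x ∈ K, ∃ m, n ≤ m ∧ m ≤ b ∧ x m = true := by
    intro n
    have hopen : ∀ m, IsOpen ((fun x : ℕ → Bool => x m) ⁻¹' {true}) := fun m =>
      (isOpen_discrete ({true} : Set Bool)).preimage (continuous_apply m)
    obtain ⟨t, ht⟩ := hK.elim_finite_subcover
      (fun m : {m // n ≤ m} => (fun x : ℕ → Bool => x m) ⁻¹' {true}) (fun m => hopen m) fun x hx => by
        obtain ⟨m, hm, hxm⟩ := notMem_finiteIndicators_iff.1 (disjoint_left.1 hd hx) n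
        exact mem_iUnion.2 ⟨⟨m, hm⟩, hxm⟩
    refine ⟨t.sup (fun m => m.1), fun x hx => ?_⟩
    obtain ⟨m, hmt, hxm⟩ := mem_iUnion₂.1 (ht hx)
    exact ⟨m, m.2, Finset.le_sup (f := fun m : {m // n ≤ m} => m.1) hmt, hxm⟩
  choose b hb using hgap
  let G : ℕ → ℕ := fun n => (Finset.range (n + 1)).sup b
  have hG : ∀ m n, m ≤ n → b m ≤ G n := fun m n h =>
    Finset.le_sup (f := b) (Finset.mem_range.2 (Nat.lt_succ_of_le h))
  let g : ℕ → ℕ := fun n => Nat.rec (G 0) (fun _ p => G (p + 1)) n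
  refine ⟨g, fun f hf n => ?_⟩
  let h : ℕ → ℕ := fun n => ∑ k ∈ Finset.range (n + 1), (f k + 1)
  have hmono : StrictMono h := strictMono_sum_range_succ f
  have hh : ∀ n, h n ≤ g n := by
    intro n
    induction n with
    | zero =>
      obtain ⟨m, -, hm, hfm⟩ := hb 0 _ hf
      obtain ⟨k, rfl⟩ := partialSumsIndicator_eq_true.1 hfm
      exact (hmono.monotone (Nat.zero_le k)).trans (hm.trans (hG 0 0 le_rfl))
    | succ n ih =>
      obtain ⟨m, hnm, hm, hfm⟩ := hb (h n + 1) _ hf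
      obtain ⟨k, rfl⟩ := partialSumsIndicator_eq_true.1 hfm
      have hk : n + 1 ≤ k := hmono.lt_iff_lt.1 (Nat.lt_of_succ_le hnm)
      exact (hmono.monotone hk).trans (hm.trans (hG _ _ (Nat.succ_le_succ ih)))
  refine le_trans ?_ (hh n)
  have := Finset.single_le_sum (f := fun k => f k + 1) (fun _ _ => Nat.zero_le _)
    (Finset.self_mem_range_succ n)
  exact (Nat.le_succ _).trans this

/-- A form of the Menger property: for every function `G` with values in `ℕ → ℕ` whose coordinates
are upper semicontinuous at the points of `M`, some `g : ℕ → ℕ` is not everywhere strictly dominated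
by `G y` for any `y ∈ M`. -/
def IsMengerSet {Y : Type*} [TopologicalSpace Y] (M : Set Y) : Prop :=
  ∀ G : Y → ℕ → ℕ, (∀ q ∈ M, ∀ n, ∀ᶠ y in 𝓝 q, G y n ≤ G q n) →
    ∃ g : ℕ → ℕ, ∀ y ∈ M, ∃ n, G y n ≤ g n

theorem IsMengerSet.baireSpace {Y : Type*} [MetricSpace Y] [CompactSpace Y] {M : Set Y}
    (hM : IsMengerSet M) {C : Set (NonemptyCompacts Y)} (hCM : ∀ K ∈ C, Disjoint (K : Set Y) M)
    (hC : ∀ K ∈ closure C, Disjoint (K : Set Y) M → K ∈ C) : BaireSpace C := by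
  classical
  refine ⟨fun O hO hd => ?_⟩
  choose O' hO' hOO' using fun n => isOpen_induced_iff.1 (hO n)
  have hstep : ∀ (n : ℕ) (K : C) (δ : ℝ), 0 < δ → ∃ (K' : C) (ε : {ε : ℝ // 0 < ε}),
      (ε : ℝ) ≤ 1 / (n + 1) ∧
      Metric.closedBall (K' : NonemptyCompacts Y) ε ⊆ Metric.closedBall K.1 δ ∩ O' n := by
    intro n K δ hδ
    obtain ⟨K', hK'⟩ := (hd n).inter_open_nonempty (Subtype.val ⁻¹' Metric.ball K.1 δ)
      (Metric.isOpen_ball.preimage continuous_subtype_val) ⟨K, Metric.mem_ball_self hδ⟩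
    rw [← hOO' n] at hK'
    obtain ⟨ε, hε, hεK⟩ := Metric.nhds_basis_closedBall.mem_iff.1
      ((Metric.isOpen_ball.inter (hO' n)).mem_nhds (x := K'.1) hK')
    refine ⟨K', ⟨min ε (1 / (n + 1)), by positivity⟩, min_le_right _ _, ?_⟩
    exact (Metric.closedBall_subset_closedBall (min_le_left _ _)).trans
      (hεK.trans (inter_subset_inter_left _ Metric.ball_subset_closedBall))
  choose nextK nextε hnextε hnext using hstep
  rw [dense_iff_inter_open]
  intro W hW hWne
  obtain ⟨W', hW', rfl⟩ := isOpen_induced_iff.1 hW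
  obtain ⟨K₀, hK₀⟩ := hWne
  obtain ⟨ε₀, hε₀, hεW⟩ := Metric.nhds_basis_closedBall.mem_iff.1 (hW'.mem_nhds (x := K₀.1) hK₀)
  have hpos : ∀ (s : C × {ε : ℝ // 0 < ε}) (k : ℕ), 0 < min s.2.1 (1 / ((k : ℝ) + 1)) :=
    fun s k => lt_min s.2.2 (by positivity)
  let next : ℕ → C × {ε : ℝ // 0 < ε} → ℕ → C × {ε : ℝ // 0 < ε} := fun n s k =>
    (nextK n s.1 _ (hpos s k), nextε n s.1 _ (hpos s k))
  let s₀ : C × {ε : ℝ // 0 < ε} := (K₀, ⟨ε₀, hε₀⟩)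
  let u : (ℕ → ℕ) → ℕ → C × {ε : ℝ // 0 < ε} := fun g n =>
    Nat.rec s₀ (fun n s => next n s (g n)) n
  let r : Y → C × {ε : ℝ // 0 < ε} → ℕ := fun y s =>
    sInf {k : ℕ | 1 / ((k : ℝ) + 1) < Metric.infDist y (s.1.1 : Set Y)}
  have hr : ∀ y ∈ M, ∀ s, 1 / ((r y s : ℝ) + 1) < Metric.infDist y (s.1.1 : Set Y) := by
    intro y hy s
    refine Nat.sInf_mem (s := {k : ℕ | 1 / ((k : ℝ) + 1) < Metric.infDist y (s.1.1 : Set Y)}) ?_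
    exact exists_nat_one_div_lt <| (s.1.1.isCompact.isClosed.notMem_iff_infDist_pos s.1.1.nonempty).1
      (disjoint_right.1 (hCM _ s.1.2) hy)
  have hrusc : ∀ q ∈ M, ∀ s, ∀ᶠ y in 𝓝 q, r y s ≤ r q s := by
    intro q hq s
    filter_upwards [(Metric.continuous_infDist_pt (s.1.1 : Set Y)).continuousAt.eventually
      (lt_mem_nhds (hr q hq s))] with y hy
    exact Nat.sInf_le hy
  let T : Y → ℕ → Finset (C × {ε : ℝ // 0 < ε}) := fun y n =>
    Nat.rec {s₀} (fun n t => t.biUnion fun s => (Finset.range (r y s)).image (next n s)) n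
  have hTusc : ∀ q ∈ M, ∀ n, ∀ᶠ y in 𝓝 q, T y n ⊆ T q n := by
    intro q hq n
    induction n with
    | zero => exact Eventually.of_forall fun y => Finset.Subset.refl _
    | succ n ih =>
      filter_upwards [ih, (Finset.eventually_all (T q n)).2 fun s _ => hrusc q hq s] with y hy hs
      refine Finset.biUnion_subset.2 fun s hsy => ?_
      refine Finset.Subset.trans ?_ (Finset.subset_biUnion_of_mem _ (hy hsy))
      exact Finset.image_subset_image (Finset.range_subset_range.2 (hs s (hy hsy)))
  obtain ⟨g, hg⟩ := hM (fun y n => (T y n).sup (r y)) fun q hq n => by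
    filter_upwards [hTusc q hq n, (Finset.eventually_all (T q n)).2 fun s _ => hrusc q hq s]
      with y hy hs
    exact Finset.sup_le fun s hsy =>
      (hs s (hy hsy)).trans (Finset.le_sup (f := r q) (hy hsy))
  have hwin : ∀ y ∈ M, ∃ n, r y (u g n) ≤ g n := by
    intro y hy
    by_contra! h
    have hmem : ∀ n, u g n ∈ T y n := by
      intro n
      induction n with
      | zero => exact Finset.mem_singleton_self _
      | succ n ih =>
        exact Finset.mem_biUnion.2
          ⟨u g n, ih, Finset.mem_image.2 ⟨g n, Finset.mem_range.2 (h n), rfl⟩⟩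
    obtain ⟨n, hn⟩ := hg y hy
    exact ((Finset.le_sup (f := r y) (hmem n)).trans hn).not_gt (h n)
  let B : ℕ → Set (NonemptyCompacts Y) := fun n => Metric.closedBall (u g n).1.1 (u g n).2
  have hB : ∀ n, B (n + 1) ⊆
      Metric.closedBall (u g n).1.1 (min (u g n).2.1 (1 / ((g n : ℝ) + 1))) ∩ O' n :=
    fun n => hnext n _ _ _
  obtain ⟨K, hK⟩ := IsCompact.nonempty_iInter_of_sequence_nonempty_isCompact_isClosed B
    (fun n => (hB n).trans (inter_subset_left.trans
      (Metric.closedBall_subset_closedBall (min_le_left _ _))))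
    (fun n => ⟨_, Metric.mem_closedBall_self (u g n).2.2.le⟩)
    Metric.isClosed_closedBall.isCompact (fun n => Metric.isClosed_closedBall)
  rw [mem_iInter] at hK
  have hKC : K ∈ C := by
    refine hC K (Metric.mem_closure_iff.2 fun ε hε => ?_) (disjoint_left.2 fun y hyK hyM => ?_)
    · obtain ⟨n, hn⟩ := exists_nat_one_div_lt hε
      exact ⟨_, (u g (n + 1)).1.2, ((hK (n + 1)).trans (hnextε n _ _ _)).trans_lt hn⟩
    · obtain ⟨n, hn⟩ := hwin y hyM
      have hdist : dist K (u g n).1.1 ≤ 1 / ((g n : ℝ) + 1) :=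
        (hB n (hK (n + 1))).1.trans (min_le_right _ _)
      have hinf : Metric.infDist y ((u g n).1.1 : Set Y) ≤ dist K (u g n).1.1 :=
        Metric.infDist_le_hausdorffDist_of_mem hyK
          (Metric.hausdorffEDist_ne_top_of_nonempty_of_bounded K.nonempty (u g n).1.1.nonempty
            K.isCompact.isBounded (u g n).1.1.isCompact.isBounded)
      have hanti : 1 / ((g n : ℝ) + 1) ≤ 1 / ((r y (u g n) : ℝ) + 1) := by
        gcongr
      linarith [hr y hyM (u g n)]
  refine ⟨⟨K, hKC⟩, hεW (hK 0), mem_iInter.2 fun n => ?_⟩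
  rw [← hOO' n]
  exact (hB n (hK (n + 1))).2

section ScaleSet

variable {Y : Type*} {o : Ordinal.{0}} {f : Ordinal.{0} → ℕ → ℕ} {e : (ℕ → Bool) → Y}

/-- The image under `e` of the finite subsets of `ℕ` and of the sets of partial sums of the
members of index less than `o` of the family `f`. -/
def scaleSet (o : Ordinal.{0}) (f : Ordinal.{0} → ℕ → ℕ) (e : (ℕ → Bool) → Y) : Set Y :=
  e '' finiteIndicators ∪ (fun i => e (partialSumsIndicator (f i))) '' Iio o

theorem exists_bound_of_isOpen [TopologicalSpace Y] (he : Continuous e) {U : Set Y}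
    (hU : IsOpen U) (hQ : e '' finiteIndicators ⊆ U) :
    ∃ g : ℕ → ℕ, ∀ f, e (partialSumsIndicator f) ∉ U → ∀ n, f n ≤ g n :=
  (hU.preimage he).isClosed_compl.isCompact.exists_bound_of_disjoint_finiteIndicators
    (disjoint_left.2 fun _ hx hxQ => hx (hQ (mem_image_of_mem e hxQ)))

theorem exists_forall_mem_of_isOpen [TopologicalSpace Y] (he : Continuous e)
    (hf : ∀ g : ℕ → ℕ, ∃ i < o, ∀ j, i ≤ j → j < o → ¬ f j ≤ᶠ[atTop] g)
    {U : Set Y} (hU : IsOpen U) (hQ : e '' finiteIndicators ⊆ U) :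
    ∃ i < o, ∀ j, i ≤ j → j < o → e (partialSumsIndicator (f j)) ∈ U := by
  obtain ⟨g, hg⟩ := exists_bound_of_isOpen he hU hQ
  obtain ⟨i, hi, hij⟩ := hf g
  refine ⟨i, hi, fun j h hj => by_contra fun hU => hij j h hj ?_⟩
  exact Eventually.of_forall (hg _ hU)

theorem isMengerSet_scaleSet [TopologicalSpace Y] (he : Continuous e)
    (hbd : ∀ i < o, ∀ F : Ordinal.{0} → ℕ → ℕ, ∃ g : ℕ → ℕ, ∀ j < i, F j ≤ᶠ[atTop] g)
    (hf : ∀ g : ℕ → ℕ, ∃ i < o, ∀ j, i ≤ j → j < o → ¬ f j ≤ᶠ[atTop] g) :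
    IsMengerSet (scaleSet o f e) := by
  intro G hG
  obtain ⟨q, hq⟩ := (countable_finiteIndicators.image e).exists_eq_range
    ((range_nonempty _).image e)
  let U : Set Y := interior {y | ∃ n, G y n ≤ G (q n) n}
  have hQU : e '' finiteIndicators ⊆ U := by
    rw [hq]
    rintro _ ⟨n, rfl⟩
    refine mem_interior_iff_mem_nhds.2 ?_
    filter_upwards [hG (q n) (Or.inl (hq ▸ mem_range_self n)) n] with y hy
    exact ⟨n, hy⟩
  obtain ⟨i, hi, hij⟩ := exists_forall_mem_of_isOpen he hf isOpen_interior hQU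
  obtain ⟨g, hg⟩ := hbd i hi fun j => G (e (partialSumsIndicator (f j)))
  have hU : ∀ y ∈ U, ∃ n, G y n ≤ max (G (q n) n) (g n) := fun y hy => by
    obtain ⟨n, hn⟩ := interior_subset hy
    exact ⟨n, hn.trans (le_max_left _ _)⟩
  refine ⟨fun n => max (G (q n) n) (g n), ?_⟩
  rintro y (hy | ⟨j, hj, rfl⟩)
  · exact hU y (hQU hy)
  · rcases lt_or_ge j i with hji | hji
    · obtain ⟨n, hn⟩ := (hg j hji).exists
      exact ⟨n, hn.trans (le_max_right _ _)⟩
    · exact hU _ (hij j hji hj)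

theorem not_measurableSet_scaleSet [TopologicalSpace Y] [PolishSpace Y] [MeasurableSpace Y]
    [BorelSpace Y] (he : Continuous e) (hinj : Function.Injective e)
    (hbd : ∀ i < o, ∀ F : Ordinal.{0} → ℕ → ℕ, ∃ g : ℕ → ℕ, ∀ j < i, F j ≤ᶠ[atTop] g)
    (hf : ∀ g : ℕ → ℕ, ∃ i < o, ∀ j, i ≤ j → j < o → ¬ f j ≤ᶠ[atTop] g) :
    ¬ MeasurableSet (scaleSet o f e) := by
  classical
  intro hmeas
  have hmeas' := hmeas.diff (countable_finiteIndicators.image e).measurableSet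
  set B := scaleSet o f e \ e '' finiteIndicators
  have hBmem : ∀ i < o, e (partialSumsIndicator (f i)) ∈ B := fun i hi =>
    ⟨Or.inr ⟨i, hi, rfl⟩, fun h =>
      partialSumsIndicator_notMem_finiteIndicators (f i) (hinj.mem_set_image.1 h)⟩
  have hunc : ¬ B.Countable := by
    intro hc
    obtain ⟨i₀, hi₀, -⟩ := hf 0
    obtain ⟨b, hb⟩ := hc.exists_eq_range ⟨_, hBmem i₀ hi₀⟩
    have hbound : ∀ n, ∃ g : ℕ → ℕ, ∀ h, e (partialSumsIndicator h) = b n → ∀ k, h k ≤ g k := by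
      intro n
      have hbn : b n ∈ B := hb ▸ mem_range_self n
      obtain ⟨g, hg⟩ := exists_bound_of_isOpen he (isOpen_compl_singleton (x := b n))
        fun x hx hxb => hbn.2 (mem_singleton_iff.1 hxb ▸ hx)
      exact ⟨g, fun h hh => hg h fun hn => hn hh⟩
    choose g hg using hbound
    obtain ⟨i, hi, hij⟩ := hf fun k => (Finset.range (k + 1)).sup fun n => g n k
    refine hij i le_rfl hi ?_
    obtain ⟨n, hn⟩ : e (partialSumsIndicator (f i)) ∈ range b := hb ▸ hBmem i hi
    filter_upwards [eventually_ge_atTop n] with k hk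
    exact (hg n _ hn.symm k).trans
      (Finset.le_sup (f := fun n => g n k) (Finset.mem_range.2 (Nat.lt_succ_of_le hk)))
  obtain ⟨c, hcB, hc, hcinj⟩ :
      ∃ c : (ℕ → Bool) → Y, range c ⊆ B ∧ Continuous c ∧ Function.Injective c := by
    obtain ⟨t', ht', hpol, hclosed, -⟩ := hmeas'.isClopenable
    obtain ⟨c, hcB, hc, hcinj⟩ := @IsClosed.exists_nat_bool_injection_of_not_countable Y t' hpol
      B hclosed hunc
    exact ⟨c, hcB, continuous_le_rng ht' hc, hcinj⟩
  obtain ⟨i, hi, hij⟩ := exists_forall_mem_of_isOpen he hf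
    (isCompact_range hc).isClosed.isOpen_compl fun x hx hxc => (hcB hxc).2 hx
  let graph : (ℕ → ℕ) → ℕ → Bool := fun g n => decide (g n.unpair.1 = n.unpair.2)
  have hgraph : Function.Injective graph := by
    intro g h hgh
    funext n
    have := congrFun hgh (Nat.pair n (g n))
    simp only [graph, Nat.unpair_pair, decide_true] at this
    exact (of_decide_eq_true this.symm).symm
  obtain ⟨g, hg⟩ := hbd i hi fun j =>
    Function.invFun (c ∘ graph) (e (partialSumsIndicator (f j)))
  have hmem : c (graph (g + 1)) ∈ B := hcB (mem_range_self _)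
  obtain ⟨j, hj, hje⟩ := hmem.1.resolve_left hmem.2
  have hji : j < i := lt_of_not_ge fun h => hij j h hj ⟨graph (g + 1), hje.symm⟩
  have hgj := hg j hji
  have hinv : Function.invFun (c ∘ graph) (e (partialSumsIndicator (f j))) = g + 1 := by
    rw [show e (partialSumsIndicator (f j)) = (c ∘ graph) (g + 1) from hje]
    exact Function.leftInverse_invFun (hcinj.comp hgraph) _
  rw [hinv] at hgj
  obtain ⟨n, hn⟩ := hgj.exists
  simp at hn

end ScaleSet

namespace Hyper

/-- The inclusion of the hyperspace of a subspace in the space of nonempty compact sets of the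
ambient space. -/
def toNonemptyCompacts {Y : Type*} [TopologicalSpace Y] {X : Set Y} (K : Hyper X) :
    NonemptyCompacts Y :=
  ⟨⟨Subtype.val '' K.1, K.2.1.image continuous_subtype_val⟩, K.2.2.image _⟩

theorem isEmbedding_toNonemptyCompacts {Y : Type*} [TopologicalSpace Y] {X : Set Y} :
    IsEmbedding (toNonemptyCompacts (X := X)) := by
  let _ : TopologicalSpace (Set X) := .vietoris X
  let _ : TopologicalSpace (Set Y) := .vietoris Y
  have hval : IsEmbedding (fun K : Hyper X => K.1) := by
    refine ⟨⟨?_⟩, Subtype.val_injective⟩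
    change TopologicalSpace.generateFrom _ = TopologicalSpace.induced _ (.generateFrom _)
    rw [induced_generateFrom_eq, image_union]
    congr 2 <;> ext s <;> constructor
    · rintro ⟨U, hU, rfl⟩
      exact ⟨_, ⟨U, hU, rfl⟩, rfl⟩
    · rintro ⟨_, ⟨U, hU, rfl⟩, rfl⟩
      exact ⟨U, hU, rfl⟩
    · rintro ⟨U, hU, rfl⟩
      exact ⟨_, ⟨U, hU, rfl⟩, rfl⟩
    · rintro ⟨_, ⟨U, hU, rfl⟩, rfl⟩
      exact ⟨U, hU, rfl⟩
  refine IsEmbedding.of_comp_iff (NonemptyCompacts.isEmbedding_coe (α := Y)) |>.1 ?_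
  exact IsEmbedding.subtypeVal.image_vietoris.comp hval

theorem range_toNonemptyCompacts {Y : Type*} [TopologicalSpace Y] {X : Set Y} :
    range (toNonemptyCompacts (X := X)) = {K : NonemptyCompacts Y | (K : Set Y) ⊆ X} := by
  ext K
  constructor
  · rintro ⟨L, rfl⟩
    exact Subtype.coe_image_subset X L.1
  · intro hK
    have hKX : (K : Set Y) ⊆ X := hK
    have himage : Subtype.val '' (Subtype.val ⁻¹' (K : Set Y) : Set X) = K := by
      rwa [Subtype.image_preimage_coe, inter_eq_right]
    refine ⟨⟨Subtype.val ⁻¹' (K : Set Y), ?_, ?_⟩, NonemptyCompacts.ext himage⟩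
    · rw [Subtype.isCompact_iff, himage]
      exact K.isCompact
    · rw [← image_nonempty (f := Subtype.val), himage]
      exact K.nonempty

end Hyper

theorem IsMengerSet.hereditarilyBaire_hyper_compl {Y : Type*} [MetricSpace Y] [CompactSpace Y]
    {M : Set Y} (hM : IsMengerSet M) : HereditarilyBaire (Hyper (Mᶜ : Set Y)) := by
  intro C hC
  have hemb := Hyper.isEmbedding_toNonemptyCompacts (X := Mᶜ)
  have : BaireSpace (Hyper.toNonemptyCompacts '' C) := by
    refine hM.baireSpace ?_ fun K hK hKM => ?_
    · rintro _ ⟨K, -, rfl⟩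
      exact disjoint_left.2 fun y ⟨x, _, hx⟩ hy => x.2 (hx ▸ hy)
    · obtain ⟨L, rfl⟩ : K ∈ range (Hyper.toNonemptyCompacts (X := Mᶜ)) := by
        rw [Hyper.range_toNonemptyCompacts]
        exact hKM.subset_compl_right
      refine mem_image_of_mem _ ?_
      rw [← hC.closure_eq, hemb.isInducing.closure_eq_preimage_closure_image]
      exact hK
  exact (hemb.homeomorphImage C).symm.isOpenQuotientMap.baireSpace

theorem exists_continuous_injective_unitInterval :
    ∃ e : (ℕ → Bool) → unitInterval, Continuous e ∧ Function.Injective e :=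
  ⟨fun x => inclusion cantorSet_subset_unitInterval (cantorSetHomeomorphNatToBool.symm x),
    (continuous_inclusion cantorSet_subset_unitInterval).comp
      cantorSetHomeomorphNatToBool.symm.continuous,
    (inclusion_injective cantorSet_subset_unitInterval).comp
      cantorSetHomeomorphNatToBool.symm.injective⟩

/-- There exists a (separable metrizable) subspace `X` of `[0,1]` that is not
Polish but whose Vietoris hyperspace `K(X)` is hereditarily Baire. -/
theorem exists_nonPolish_with_hereditarilyBaire_hyperspace :
    ∃ X : Set unitInterval, ¬ PolishSpace ↥X ∧ HereditarilyBaire (Hyper ↥X) := by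
  obtain ⟨o, f, hbd, hf⟩ := exists_unbounded_scale
  obtain ⟨e, he, hinj⟩ := exists_continuous_injective_unitInterval
  refine ⟨(scaleSet o f e)ᶜ, fun hpol => ?_,
    (isMengerSet_scaleSet he hbd hf).hereditarilyBaire_hyper_compl⟩
  have hmeas := MeasureTheory.measurableSet_range_of_continuous_injective
    (continuous_subtype_val (p := (· ∈ (scaleSet o f e)ᶜ))) Subtype.val_injective
  rw [Subtype.range_val] at hmeas
  exact not_measurableSet_scaleSet he hinj hbd hf hmeas.of_compl
end

section
/- If X is a metrizable Prohorov space, then the space P_r(X) of Radon Borel probability measures on X with the weak topology is hereditarily Baire. -/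
open MeasureTheory

/-- `X` is Prohorov: every compact subset of the space `P_r(X)` of Radon Borel
probability measures is uniformly tight. -/
def Prohorov (X : Type*) [TopologicalSpace X] [MeasurableSpace X]
    [OpensMeasurableSpace X] : Prop :=
  ∀ C : Set {μ : ProbabilityMeasure X // μ.toMeasure.InnerRegular},
    IsCompact C → ∀ ε : ℝ, 0 < ε →
      ∃ K : Set X, IsCompact K ∧ ∀ μ ∈ C, (1 : ℝ) - ε < (μ.1 K : ℝ)

section Auxiliary

open Filter Topology Set ENNReal NNReal

namespace MeasureTheory

variable {X : Type*} [TopologicalSpace X] [MeasurableSpace X]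

theorem innerRegular_of_forall_exists_isCompact [TopologicalSpace.MetrizableSpace X] [BorelSpace X]
    {μ : Measure X} [IsFiniteMeasure μ]
    (h : ∀ ε, 0 < ε → ∃ K, IsCompact K ∧ μ Kᶜ < ε) : μ.InnerRegular := by
  let := TopologicalSpace.metrizableSpaceMetric X
  have hcl : μ.InnerRegularWRT IsClosed MeasurableSet := by
    intro A hA r hr
    exact hA.exists_lt_isClosed_of_ne_top (measure_ne_top μ A) hr
  have := innerRegularWRT_of_exists_compl_lt (p := IsCompact) (q := IsClosed) (μ := μ)
    (fun a b ha hb ↦ ha.inter_right hb) fun ε hε ↦ h ε hε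
  exact ⟨this.trans hcl⟩

instance [OpensMeasurableSpace X] : RegularSpace (FiniteMeasure X) := by
  have h : IsInducing fun (φ : WeakDual ℝ≥0 (BoundedContinuousFunction X ℝ≥0))
    (f : BoundedContinuousFunction X ℝ≥0) ↦ φ f := ⟨rfl⟩
  have h' : IsInducing (FiniteMeasure.toWeakDualBCNN : FiniteMeasure X → _) := ⟨rfl⟩
  exact (h.comp h').regularSpace

instance [OpensMeasurableSpace X] : RegularSpace (ProbabilityMeasure X) :=
  (ProbabilityMeasure.toFiniteMeasure_isEmbedding X).isInducing.regularSpace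

/-- An inner regular finite measure on a metrizable space sees only countably many open sets. -/
theorem exists_countable_isOpen_lt_measure [TopologicalSpace.MetrizableSpace X] [BorelSpace X]
    (μ : Measure X) [IsFiniteMeasure μ] [μ.InnerRegular] :
    ∃ 𝒲 : Set (Set X), 𝒲.Countable ∧ (∀ W ∈ 𝒲, IsOpen W) ∧
      ∀ U, IsOpen U → ∀ r < μ U, ∃ W ∈ 𝒲, W ⊆ U ∧ r < μ W := by
  let := TopologicalSpace.metrizableSpaceMetric X
  have htight := isTightMeasureSet_iff_exists_isCompact_measure_compl_le.1
    (isTightMeasureSet_singleton_of_innerRegular (μ := μ))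
  choose K hK hμK using fun n : ℕ ↦ htight (n + 1 : ℝ≥0∞)⁻¹ (by simp)
  have hZ : μ (⋃ n, K n)ᶜ = 0 := by
    refine le_antisymm (ge_of_tendsto' (f := fun n : ℕ ↦ ((n + 1 : ℕ) : ℝ≥0∞)⁻¹)
      ((tendsto_add_atTop_iff_nat 1).2 ENNReal.tendsto_inv_nat_nhds_zero) fun n ↦ ?_) zero_le
    refine (measure_mono (compl_subset_compl.2 (subset_iUnion K n))).trans ?_
    simpa using hμK n
  obtain ⟨c, hc, hcK⟩ : TopologicalSpace.IsSeparable (⋃ n, K n) :=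
    .iUnion fun n ↦ (hK n).isSeparable
  let 𝓑 : Set (Set X) := ⋃ x ∈ c, range fun k : ℕ ↦ Metric.ball x (1 / (k + 1 : ℝ))
  have h𝓑 : 𝓑.Countable := hc.biUnion fun x _ ↦ countable_range _
  have h𝓑o : ∀ B ∈ 𝓑, IsOpen B := by
    intro B hB
    simp only [𝓑, mem_iUnion, mem_range] at hB
    obtain ⟨x, -, k, rfl⟩ := hB
    exact Metric.isOpen_ball
  have hbasis : ∀ U, IsOpen U → ∀ y ∈ U ∩ ⋃ n, K n, ∃ B ∈ 𝓑, y ∈ B ∧ B ⊆ U := by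
    rintro U hU y ⟨hyU, hyK⟩
    obtain ⟨δ, hδ, hball⟩ := Metric.isOpen_iff.1 hU y hyU
    obtain ⟨k, hk⟩ := exists_nat_one_div_lt (half_pos hδ)
    obtain ⟨x, hx, hyx⟩ := Metric.mem_closure_iff.1 (hcK hyK) (1 / (k + 1 : ℝ)) (by positivity)
    refine ⟨Metric.ball x (1 / (k + 1 : ℝ)), mem_biUnion hx ⟨k, rfl⟩, hyx, ?_⟩
    refine (Metric.ball_subset_ball' ?_).trans hball
    rw [dist_comm]
    linarith
  refine ⟨sUnion '' {F | F.Finite ∧ F ⊆ 𝓑}, (countable_ofPred_finite_subset h𝓑).image _, ?_, ?_⟩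
  · rintro _ ⟨F, ⟨-, hF⟩, rfl⟩
    exact isOpen_sUnion fun B hB ↦ h𝓑o B (hF hB)
  · intro U hU r hr
    have hmeas : MeasurableSet (U ∩ ⋃ n, K n) :=
      hU.measurableSet.inter (.iUnion fun n ↦ (hK n).measurableSet)
    rw [← measure_inter_conull hZ] at hr
    obtain ⟨L, hLU, hL, hrL⟩ := hmeas.exists_lt_isCompact hr
    obtain ⟨F, ⟨hfin, hF⟩, hFU, hLF⟩ : ∃ F, (F.Finite ∧ F ⊆ 𝓑) ∧ ⋃₀ F ⊆ U ∧ L ⊆ ⋃₀ F := by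
      refine hL.induction_on ⟨∅, by simp⟩ ?_ ?_ ?_
      · rintro s t hst ⟨F, hF, hFU, ht⟩
        exact ⟨F, hF, hFU, hst.trans ht⟩
      · rintro s t ⟨F, hF, hFU, hs⟩ ⟨G, hG, hGU, ht⟩
        refine ⟨F ∪ G, ⟨hF.1.union hG.1, union_subset hF.2 hG.2⟩, ?_, ?_⟩ <;> rw [sUnion_union]
        · exact union_subset hFU hGU
        · exact union_subset_union hs ht
      · intro y hy
        obtain ⟨B, hB, hyB, hBU⟩ := hbasis U hU y (hLU hy)
        exact ⟨B, mem_nhdsWithin_of_mem_nhds ((h𝓑o B hB).mem_nhds hyB), {B}, by simpa using hB,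
          by simpa using hBU, by simp⟩
    exact ⟨⋃₀ F, ⟨F, ⟨hfin, hF⟩, rfl⟩, hFU, hrL.trans_le (measure_mono hLF)⟩

theorem ProbabilityMeasure.isCountablyGenerated_nhds_of_innerRegular
    [TopologicalSpace.MetrizableSpace X] [BorelSpace X] (μ : ProbabilityMeasure X)
    (hμ : μ.toMeasure.InnerRegular) : (𝓝 μ).IsCountablyGenerated := by
  let := TopologicalSpace.metrizableSpaceMetric X
  obtain ⟨𝒲, h𝒲, ho, hlt⟩ := exists_countable_isOpen_lt_measure (μ : Measure X)
  have := h𝒲.to_subtype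
  let I := {p : 𝒲 × ℚ // (Real.toNNReal p.2 : ℝ≥0∞) < (μ : Measure X) p.1}
  let L : Filter (ProbabilityMeasure X) := 
    ⨅ p : I, 𝓟 {ν | (Real.toNNReal p.1.2 : ℝ≥0∞) < (ν : Measure X) p.1.1}
  have hL : L.IsCountablyGenerated := Filter.iInf.isCountablyGenerated _
  suffices 𝓝 μ = L by rwa [this]
  refine le_antisymm ?_ ?_
  · refine le_iInf fun p ↦ le_principal_iff.2 ?_
    exact eventually_lt_of_lt_liminf (p.2.trans_le
      (ProbabilityMeasure.le_liminf_measure_open_of_tendsto tendsto_id (ho _ p.1.1.2)))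
  · refine tendsto_of_forall_isOpen_le_liminf' (L := L) (μs := id) fun G hG ↦ ?_
    refine le_of_forall_lt fun r hr ↦ ?_
    obtain ⟨W, hW, hWG, hrW⟩ := hlt G hG r hr
    obtain ⟨q, -, hrq, hqW⟩ := ENNReal.lt_iff_exists_rat_btwn.1 hrW
    refine hrq.trans_le (le_liminf_of_le (by isBoundedDefault) ?_)
    have : {ν : ProbabilityMeasure X | (Real.toNNReal q : ℝ≥0∞) < (ν : Measure X) W} ∈ L :=
      mem_iInf_of_mem (⟨(⟨W, hW⟩, q), hqW⟩ : I) (mem_principal_self _)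
    filter_upwards [this] with ν hν
    exact hν.le.trans (measure_mono hWG)

instance [TopologicalSpace.MetrizableSpace X] [BorelSpace X] :
    FirstCountableTopology {μ : ProbabilityMeasure X // μ.toMeasure.InnerRegular} where
  nhds_generated_countable μ := by
    have := ProbabilityMeasure.isCountablyGenerated_nhds_of_innerRegular μ.1 μ.2
    rw [nhds_subtype_eq_comap]
    infer_instance

end MeasureTheory

namespace BranchingConfig

/-- The first `n` digits of a binary sequence. -/
def initial (β : ℕ → Bool) (n : ℕ) : List Bool := (List.range n).map β

theorem initial_succ (β : ℕ → Bool) (n : ℕ) : initial β (n + 1) = initial β n ++ [β n] := by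
  simp [initial, List.range_succ]

theorem initial_succ' (β : ℕ → Bool) (n : ℕ) :
    initial β (n + 1) = β 0 :: initial (fun i ↦ β (i + 1)) n := by
  simp [initial, List.range_succ_eq_map, Function.comp_def]

theorem initial_ne_nil (β : ℕ → Bool) (n : ℕ) : initial β (n + 1) ≠ [] := by
  simp [initial_succ]

theorem length_initial (β : ℕ → Bool) (n : ℕ) : (initial β n).length = n := by
  simp [initial]

theorem initial_add (β : ℕ → Bool) (k n : ℕ) :
    initial β (k + n) = initial β k ++ initial (fun i ↦ β (k + i)) n := by
  simp [initial, List.range_add, Function.comp_def]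

/-- The labels met along `β`, the most recent one first. -/
def branch (a : List Bool → ℕ∞) (β : ℕ → Bool) : ℕ → List ℕ
  | 0 => []
  | n + 1 => (a (initial β (n + 1))).toNat :: branch a β n

/-- The walk along `β` stops after `n` steps. -/
def Halts (a : List Bool → ℕ∞) (β : ℕ → Bool) (n : ℕ) : Prop := a (initial β (n + 1)) = ⊤

open Classical in
/-- The node at which the walk along `β` first stops, and the root if it never does. -/
noncomputable def endpoint (a : List Bool → ℕ∞) (β : ℕ → Bool) : List ℕ :=
  if h : ∃ n, Halts a β n then branch a β (Nat.find h) else []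

theorem endpoint_eq_branch {a : List Bool → ℕ∞} {β : ℕ → Bool} {n : ℕ}
    (hlt : ∀ m < n, ¬ Halts a β m) (hn : Halts a β n) : endpoint a β = branch a β n := by
  classical
  have h : ∃ n, Halts a β n := ⟨n, hn⟩
  rw [endpoint, dif_pos h, (Nat.find_eq_iff h).2 ⟨hn, hlt⟩]

theorem endpoint_eq_nil {a : List Bool → ℕ∞} {β : ℕ → Bool} (h : ∀ n, ¬ Halts a β n) :
    endpoint a β = [] := by
  classical
  rw [endpoint, dif_neg (by simpa using h)]

theorem exists_first_halt {a : List Bool → ℕ∞} {β : ℕ → Bool} (h : ∃ n, Halts a β n) :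
    ∃ n, (∀ m < n, ¬ Halts a β m) ∧ Halts a β n := by
  classical
  exact ⟨Nat.find h, fun m hm ↦ Nat.find_min h hm, Nat.find_spec h⟩

/-- Every label of a right child bounds the depth of the subtree of its left sibling. -/
def admissible : Set (List Bool → ℕ∞) :=
  {a | ∀ u v, a (u ++ false :: v) = ⊤ ∨ (v.length : ℕ∞) ≤ a (u ++ [true])}

theorem isClosed_admissible : IsClosed admissible := by
  have : admissible = ⋂ u, ⋂ v, {a : List Bool → ℕ∞ | a (u ++ false :: v) = ⊤} ∪
      {a | (v.length : ℕ∞) ≤ a (u ++ [true])} := by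
    ext a
    simp [admissible]
  rw [this]
  refine isClosed_iInter fun u ↦ isClosed_iInter fun v ↦ IsClosed.union ?_ ?_
  · exact isClosed_eq (continuous_apply _) continuous_const
  · exact isClosed_le continuous_const (continuous_apply _)

theorem eq_of_forall_not_halts {a : List Bool → ℕ∞} (ha : a ∈ admissible) {β γ : ℕ → Bool}
    (hβ : ∀ n, ¬ Halts a β n) (hγ : ∀ n, ¬ Halts a γ n) : β = γ := by
  classical
  by_contra hne
  have hex : ∃ k, β k ≠ γ k := by
    by_contra! h
    exact hne (funext h)
  obtain ⟨k, hk, hlt⟩ : ∃ k, β k ≠ γ k ∧ ∀ i < k, β i = γ i :=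
    ⟨Nat.find hex, Nat.find_spec hex, fun i hi ↦ not_not.1 (Nat.find_min hex hi)⟩
  have hinit : initial β k = initial γ k := by
    simp only [initial, List.map_inj_left, List.mem_range]
    exact hlt
  wlog hβk : β k = false generalizing β γ
  · refine this hγ hβ (Ne.symm hne) (hex.imp fun _ h ↦ h.symm) hk.symm
      (fun i hi ↦ (hlt i hi).symm) hinit.symm ?_
    cases h1 : β k <;> cases h2 : γ k <;> simp_all
  have hγk : γ k = true := by
    cases h2 : γ k <;> simp_all
  have hγ' : a (initial β k ++ [true]) ≠ ⊤ := by
    have := hγ k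
    rwa [Halts, initial_succ, hγk, ← hinit] at this
  obtain ⟨m, hm⟩ := ENat.ne_top_iff_exists.1 hγ'
  have hβ' := hβ (k + (m + 1))
  rw [Halts, add_assoc, initial_add, initial_succ'] at hβ'
  simp only [add_zero, hβk] at hβ'
  rcases ha (initial β k) (initial (fun i ↦ β (k + (i + 1))) (m + 1)) with h | h
  · exact hβ' h
  · rw [length_initial, ← hm] at h
    norm_cast at h
    omega

theorem measurableSet_initial (P : List Bool → Prop) (n : ℕ) :
    MeasurableSet {β : ℕ → Bool | P (initial β n)} := by
  induction n generalizing P with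
  | zero => simp [initial]
  | succ n ih =>
    have : {β : ℕ → Bool | P (initial β (n + 1))} =
        ({β | β n = true} ∩ {β | P (initial β n ++ [true])}) ∪
        ({β | β n = false} ∩ {β | P (initial β n ++ [false])}) := by
      ext β
      cases h : β n <;> simp [initial_succ, h]
    rw [this]
    have hm (b : Bool) : MeasurableSet {β : ℕ → Bool | β n = b} :=
      (measurable_pi_apply n : Measurable fun β : ℕ → Bool ↦ β n) (measurableSet_singleton b)
    exact ((hm _).inter (ih fun l ↦ P (l ++ [true]))).union
      ((hm _).inter (ih fun l ↦ P (l ++ [false])))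

theorem measurableSet_branch (a : List Bool → ℕ∞) (n : ℕ) (s : List ℕ) :
    MeasurableSet {β | branch a β n = s} := by
  induction n generalizing s with
  | zero => simp [branch]
  | succ n ih =>
    cases s with
    | nil => simp [branch]
    | cons k t =>
      have : {β | branch a β (n + 1) = k :: t} =
          {β | (a (initial β (n + 1))).toNat = k} ∩ {β | branch a β n = t} := by
        ext β
        simp [branch]
      rw [this]
      exact (measurableSet_initial (fun l ↦ (a l).toNat = k) _).inter (ih t)

theorem measurableSet_endpoint (a : List Bool → ℕ∞) (s : List ℕ) :
    MeasurableSet (endpoint a ⁻¹' {s}) := by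
  have hH (n : ℕ) : MeasurableSet {β | Halts a β n} :=
    measurableSet_initial (fun l ↦ a l = ⊤) _
  have : endpoint a ⁻¹' {s} =
      (⋃ n, ((⋂ m, ⋂ (_ : m < n), {β | Halts a β m}ᶜ) ∩ {β | Halts a β n}) ∩
        {β | branch a β n = s}) ∪ ((⋂ n, {β | Halts a β n}ᶜ) ∩ {_β | s = []}) := by
    ext β
    simp only [mem_preimage, mem_singleton_iff, mem_union, mem_iUnion, mem_inter_iff, mem_iInter,
      mem_compl_iff, mem_ofPred_eq]
    by_cases h : ∃ n, Halts a β n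
    · obtain ⟨n, hlt, hn⟩ := exists_first_halt h
      constructor
      · intro hs
        exact Or.inl ⟨n, ⟨hlt, hn⟩, (endpoint_eq_branch hlt hn).symm.trans hs⟩
      · rintro (⟨m, ⟨hlt', hm⟩, hs⟩ | ⟨h', -⟩)
        · exact (endpoint_eq_branch hlt' hm).trans hs
        · exact absurd hn (h' n)
    · push Not at h
      rw [endpoint_eq_nil h]
      constructor
      · exact fun hs ↦ Or.inr ⟨h, hs.symm⟩
      · rintro (⟨m, ⟨-, hm⟩, -⟩ | ⟨-, hs⟩)
        · exact absurd hm (h m)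
        · exact hs.symm
  rw [this]
  refine (MeasurableSet.iUnion fun n ↦ ?_).union (.inter (.iInter fun n ↦ (hH n).compl) (.const _))
  exact ((MeasurableSet.iInter fun m ↦ .iInter fun _ ↦ (hH m).compl).inter (hH n)).inter
    (measurableSet_branch a n s)

theorem branch_congr {a b : List Bool → ℕ∞} {β : ℕ → Bool} {n : ℕ}
    (h : ∀ i < n, a (initial β (i + 1)) = b (initial β (i + 1))) :
    branch a β n = branch b β n := by
  induction n with
  | zero => rfl
  | succ n ih => rw [branch, branch, h n (by omega), ih fun i hi ↦ h i (by omega)]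

theorem tendsto_endpoint {Y ι : Type*} [TopologicalSpace Y] {x : List ℕ → Y}
    {V : List ℕ → Set Y} (hxV : ∀ s, x s ∈ V s) (hV : ∀ m s, V (m :: s) ⊆ V s)
    (hlim : ∀ s, ∀ W ∈ 𝓝 (x s), ∀ᶠ m in atTop, V (m :: s) ⊆ W)
    {l : Filter ι} {u : ι → List Bool → ℕ∞} {c : List Bool → ℕ∞} (hu : Tendsto u l (𝓝 c))
    {β : ℕ → Bool} (hc : ∃ n, Halts c β n) (huh : ∀ i, ∃ n, Halts (u i) β n) :
    Tendsto (fun i ↦ x (endpoint (u i) β)) l (𝓝 (x (endpoint c β))) := by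
  obtain ⟨n, hlt, hn⟩ := exists_first_halt hc
  rw [endpoint_eq_branch hlt hn]
  have hpt (t : List Bool) : Tendsto (fun i ↦ u i t) l (𝓝 (c t)) :=
    (continuous_apply t).continuousAt.tendsto.comp hu
  have heq : ∀ᶠ i in l, ∀ k ∈ Finset.range n,
      u i (initial β (k + 1)) = c (initial β (k + 1)) := by
    refine (Filter.eventually_all_finset _).2 fun k hk ↦ ?_
    have := hpt (initial β (k + 1))
    rw [ENat.nhds_eq_pure (hlt k (Finset.mem_range.1 hk))] at this
    exact tendsto_pure.1 this
  intro W hW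
  obtain ⟨M, hM⟩ := eventually_atTop.1 (hlim _ W hW)
  have hlarge : ∀ᶠ i in l, (M : ℕ∞) < u i (initial β (n + 1)) := by
    have := hpt (initial β (n + 1))
    rw [hn] at this
    exact ENat.tendsto_nhds_top_iff_natCast_lt.1 this M
  change ∀ᶠ i in l, x (endpoint (u i) β) ∈ W
  filter_upwards [heq, hlarge] with i hi hMi
  replace hi : ∀ k < n, u i (initial β (k + 1)) = c (initial β (k + 1)) :=
    fun k hk ↦ hi k (Finset.mem_range.2 hk)
  obtain ⟨N, hlt', hN⟩ := exists_first_halt (huh i)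
  rw [endpoint_eq_branch hlt' hN]
  have hnN : n ≤ N := by
    by_contra! h
    exact hlt N h ((hi N h).symm.trans hN)
  rcases hnN.eq_or_lt with rfl | hnN
  · rw [branch_congr hi]
    exact mem_of_mem_nhds hW
  · have hmono : Antitone fun k ↦ V (branch (u i) β k) := antitone_nat_of_succ_le fun k ↦ hV _ _
    have hbig : M ≤ (u i (initial β (n + 1))).toNat := by
      obtain ⟨m, hm⟩ := ENat.ne_top_iff_exists.1 (hlt' n hnN)
      rw [← hm] at hMi ⊢
      exact_mod_cast hMi.le
    refine hM _ hbig (?_ : _ ∈ V (_ :: branch c β n))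
    rw [← branch_congr hi]
    exact hmono hnN (hxV _)

/-- The configuration with the two labels `m` and the two subtrees `b` below its root. -/
def join (m : Bool → ℕ) (b : Bool → List Bool → ℕ∞) : List Bool → ℕ∞
  | [] => ⊤
  | [i] => m i
  | i :: j :: v => b i (j :: v)

theorem join_cons (m : Bool → ℕ) (b : Bool → List Bool → ℕ∞) (i : Bool) {v : List Bool}
    (hv : v ≠ []) : join m b (i :: v) = b i v := by
  obtain ⟨j, w, rfl⟩ := List.exists_cons_of_ne_nil hv
  rfl

theorem branch_join (m : Bool → ℕ) (b : Bool → List Bool → ℕ∞) (β : ℕ → Bool) (n : ℕ) :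
    branch (join m b) β (n + 1) = branch (b (β 0)) (fun i ↦ β (i + 1)) n ++ [m (β 0)] := by
  induction n with
  | zero => simp [branch, initial, join]
  | succ n ih =>
    rw [branch, ih, branch, initial_succ', join_cons _ _ _ (initial_ne_nil _ _)]
    rfl

theorem halts_join (m : Bool → ℕ) (b : Bool → List Bool → ℕ∞) (β : ℕ → Bool) (n : ℕ) :
    Halts (join m b) β (n + 1) ↔ Halts (b (β 0)) (fun i ↦ β (i + 1)) n := by
  rw [Halts, initial_succ', join_cons _ _ _ (initial_ne_nil _ _), Halts]

theorem not_halts_join_zero (m : Bool → ℕ) (b : Bool → List Bool → ℕ∞) (β : ℕ → Bool) :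
    ¬ Halts (join m b) β 0 := by
  simp [Halts, initial, join]

/-- If the tree `T` has no infinite path, some admissible walk always stops, off `T`. -/
theorem exists_admissible_endpoint_notMem {T : Set (List ℕ)}
    (hT : ¬ ∃ σ : ℕ → List ℕ, σ 0 = [] ∧ ∀ n, σ n ∈ T ∧ ∃ m, σ (n + 1) = m :: σ n) :
    ∃ a ∈ admissible, ∀ β, (∃ n, Halts a β n) ∧ endpoint a β ∉ T := by
  let Good (s : List ℕ) : Prop := ∃ a ∈ admissible, (∃ d : ℕ, ∀ t : List Bool, d < t.length →
    a t = ⊤) ∧ ∀ β, (∃ n, Halts a β n) ∧ endpoint a β ++ s ∉ T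
  have hleaf (s : List ℕ) (hs : s ∉ T) : Good s := by
    refine ⟨fun _ ↦ ⊤, fun _ _ ↦ Or.inl rfl, ⟨0, fun _ _ ↦ rfl⟩, fun β ↦ ⟨⟨0, rfl⟩, ?_⟩⟩
    have hhalt : Halts (fun _ ↦ ⊤) β 0 := rfl
    rwa [endpoint_eq_branch (by simp) hhalt]
  have hnode (s : List ℕ) (hs : ∀ m, Good (m :: s)) : Good s := by
    obtain ⟨a₀, ha₀, ⟨d₀, hd₀⟩, h₀⟩ := hs 0
    obtain ⟨a₁, ha₁, ⟨d₁, hd₁⟩, h₁⟩ := hs d₀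
    let m : Bool → ℕ := fun i ↦ if i then d₀ else 0
    let b : Bool → List Bool → ℕ∞ := fun i ↦ if i then a₁ else a₀
    have hb (i : Bool) : b i ∈ admissible := by cases i <;> assumption
    have hd (i : Bool) (t : List Bool) (ht : max d₀ d₁ < t.length) : b i t = ⊤ := by
      cases i
      · exact hd₀ t (by omega)
      · exact hd₁ t (by omega)
    have hβ (β : ℕ → Bool) : (∃ n, Halts (b (β 0)) (fun i ↦ β (i + 1)) n) ∧
        endpoint (b (β 0)) (fun i ↦ β (i + 1)) ++ m (β 0) :: s ∉ T := by
      cases β 0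
      · exact h₀ _
      · exact h₁ _
    refine ⟨join m b, fun u v ↦ ?_, ⟨max d₀ d₁ + 1, fun t ht ↦ ?_⟩, fun β ↦ ?_⟩
    · cases u with
      | nil =>
        rcases eq_or_ne v [] with rfl | hv
        · simp
        · rw [List.nil_append, List.nil_append, join_cons _ _ _ hv]
          rcases lt_or_ge d₀ v.length with h | h
          · exact Or.inl (hd₀ v h)
          · exact Or.inr (by simpa [join, m] using h)
      | cons i u =>
        rw [List.cons_append, List.cons_append, join_cons _ _ _ (by simp),
          join_cons _ _ _ (by simp)]
        exact hb i u v
    · cases t with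
      | nil => simp at ht
      | cons i t =>
        simp only [List.length_cons, Nat.add_lt_add_iff_right] at ht
        rw [join_cons _ _ _ (List.ne_nil_of_length_pos (by omega))]
        exact hd i t ht
    · obtain ⟨hh, he⟩ := hβ β
      obtain ⟨n, hlt, hn⟩ := exists_first_halt hh
      have hn' := (halts_join m b β n).2 hn
      have hlt' : ∀ k < n + 1, ¬ Halts (join m b) β k := by
        rintro (_ | k) hk
        · exact not_halts_join_zero m b β
        · rw [halts_join]
          exact hlt k (by omega)
      refine ⟨⟨_, hn'⟩, ?_⟩
      rw [endpoint_eq_branch hlt' hn', branch_join, List.append_assoc]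
      rwa [endpoint_eq_branch hlt hn] at he
  by_cases hroot : Good []
  · obtain ⟨a, ha, -, hβ⟩ := hroot
    exact ⟨a, ha, fun β ↦ by simpa using hβ β⟩
  · exfalso
    have hstep (s : {s // ¬ Good s}) : ∃ m, ¬ Good (m :: s.1) := by
      by_contra! h
      exact s.2 (hnode _ h)
    choose next hnext using hstep
    let σ : ℕ → {s // ¬ Good s} := Nat.rec ⟨[], hroot⟩ fun _ s ↦ ⟨next s :: s.1, hnext s⟩
    exact hT ⟨fun n ↦ (σ n).1, rfl, fun n ↦
      ⟨by_contra fun h ↦ (σ n).2 (hleaf _ h), next (σ n), rfl⟩⟩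

end BranchingConfig

/-- A non-Baire regular first countable space carries a scheme of open sets, indexed by the tree of
finite sequences of integers, in which the children of a node accumulate at the point marking it
while no point is common to the closures along an infinite path. -/
theorem exists_openScheme_of_not_baireSpace {Y : Type*} [TopologicalSpace Y] [RegularSpace Y]
    [FirstCountableTopology Y] (hY : ¬ BaireSpace Y) :
    ∃ (x : List ℕ → Y) (V : List ℕ → Set Y), (∀ s, x s ∈ V s) ∧ (∀ m s, V (m :: s) ⊆ V s) ∧
      (∀ s, ∀ W ∈ 𝓝 (x s), ∀ᶠ m in atTop, V (m :: s) ⊆ W) ∧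
      ∀ σ : ℕ → List ℕ, σ 0 = [] → (∀ n, ∃ m, σ (n + 1) = m :: σ n) →
        ⋂ n, closure (V (σ n)) = ∅ := by
  obtain ⟨f, hfo, hfd, hf⟩ : ∃ f : ℕ → Set Y, (∀ n, IsOpen (f n)) ∧ (∀ n, Dense (f n)) ∧
      ¬ Dense (⋂ n, f n) := by
    by_contra! h
    exact hY ⟨fun f hfo hfd ↦ h f hfo hfd⟩
  obtain ⟨U, hU, ⟨y, hy⟩, hUf⟩ : ∃ U : Set Y, IsOpen U ∧ U.Nonempty ∧ U ∩ ⋂ n, f n = ∅ := by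
    simpa [dense_iff_inter_open, not_nonempty_iff_eq_empty] using hf
  have hstep (n m : ℕ) (p : {p : Y × Set Y // IsOpen p.2 ∧ p.1 ∈ p.2}) :
      ∃ q : {p : Y × Set Y // IsOpen p.2 ∧ p.1 ∈ p.2},
        closure q.1.2 ⊆ p.1.2 ∩ f n ∧ q.1.2 ⊆ (𝓝 p.1.1).exists_antitone_basis.choose m := by
    obtain ⟨⟨y, V⟩, hV, hyV⟩ := p
    have hB := (𝓝 y).exists_antitone_basis.choose_spec
    set B := (𝓝 y).exists_antitone_basis.choose
    have hnhds : V ∩ interior (B m) ∈ 𝓝 y :=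
      inter_mem (hV.mem_nhds hyV) (interior_mem_nhds.2 (hB.mem m))
    obtain ⟨z, ⟨hzV, hzB⟩, hzf⟩ := (hfd n).inter_open_nonempty _ (hV.inter isOpen_interior)
      ⟨y, mem_of_mem_nhds hnhds⟩
    obtain ⟨F, hF, hFc, hFs⟩ := exists_mem_nhds_isClosed_subset
      (((hV.inter isOpen_interior).inter (hfo n)).mem_nhds ⟨⟨hzV, hzB⟩, hzf⟩)
    refine ⟨⟨(z, interior F), isOpen_interior, mem_interior_iff_mem_nhds.2 hF⟩, ?_, ?_⟩
    · refine (closure_minimal interior_subset hFc).trans fun w hw ↦ ?_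
      exact ⟨(hFs hw).1.1, (hFs hw).2⟩
    · exact fun w hw ↦ interior_subset (hFs (interior_subset hw)).1.2
  choose next hnext hnear using hstep
  let node : List ℕ → {p : Y × Set Y // IsOpen p.2 ∧ p.1 ∈ p.2} := fun s ↦
    List.rec ⟨(y, U), hU, hy⟩ (fun m t p ↦ next t.length m p) s
  have hcl (m : ℕ) (s : List ℕ) :
      closure (node (m :: s)).1.2 ⊆ (node s).1.2 ∩ f s.length := hnext _ _ _
  refine ⟨fun s ↦ (node s).1.1, fun s ↦ (node s).1.2, fun s ↦ (node s).2.2,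
    fun m s ↦ (subset_closure.trans (hcl m s)).trans inter_subset_left, fun s W hW ↦ ?_,
    fun σ h0 hσ ↦ ?_⟩
  · have hB := (𝓝 (node s).1.1).exists_antitone_basis.choose_spec
    obtain ⟨M, -, hM⟩ := hB.1.mem_iff.1 hW
    filter_upwards [eventually_ge_atTop M] with m hm
    exact (hnear _ _ _).trans ((hB.2 hm).trans hM)
  · have hlen (n : ℕ) : (σ n).length = n := by
      induction n with
      | zero => simp [h0]
      | succ n ih =>
        obtain ⟨m, hm⟩ := hσ n
        simp [hm, ih]
    refine eq_empty_of_subset_empty (Subset.trans (fun z hz ↦ ?_) hUf.subset)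
    have hz' (n : ℕ) : z ∈ (node (σ n)).1.2 ∩ f n := by
      obtain ⟨m, hm⟩ := hσ n
      have := mem_iInter.1 hz (n + 1)
      rw [hm] at this
      simpa only [hlen] using hcl m (σ n) this
    refine ⟨?_, mem_iInter.2 fun n ↦ (hz' n).2⟩
    have := (hz' 0).1
    rwa [h0] at this

namespace MeasureTheory

section Mixture

variable {Ω ι X : Type*} [MeasurableSpace Ω] [MeasurableSpace X]

theorem measurable_comp_of_countable [Countable ι] {g : Ω → ι}
    (hg : ∀ i, MeasurableSet (g ⁻¹' {i}))
    (F : ι → ℝ≥0∞) : Measurable fun ω ↦ F (g ω) := by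
  let : MeasurableSpace ι := ⊤
  exact measurable_from_top.comp (measurable_to_countable' hg)

/-- The mixture of a countable family of measures, the index being drawn at random. -/
noncomputable def mixture (ρ : Measure Ω) (g : Ω → ι) (x : ι → Measure X) : Measure X :=
  Measure.sum fun i ↦ ρ (g ⁻¹' {i}) • x i

theorem lintegral_mixture [Countable ι] (ρ : Measure Ω) {g : Ω → ι}
    (hg : ∀ i, MeasurableSet (g ⁻¹' {i}))
    (x : ι → Measure X) (f : X → ℝ≥0∞) :
    ∫⁻ y, f y ∂mixture ρ g x = ∫⁻ ω, ∫⁻ y, f y ∂x (g ω) ∂ρ := by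
  let : MeasurableSpace ι := ⊤
  have hgm : Measurable g := measurable_to_countable' hg
  rw [← lintegral_map (f := fun i ↦ ∫⁻ y, f y ∂x i) measurable_from_top hgm,
    lintegral_countable' (μ := ρ.map g), mixture, lintegral_sum_measure]
  refine tsum_congr fun i ↦ ?_
  rw [lintegral_smul_measure, Measure.map_apply hgm (measurableSet_singleton i), smul_eq_mul,
    mul_comm]

theorem mixture_apply [Countable ι] (ρ : Measure Ω) {g : Ω → ι}
    (hg : ∀ i, MeasurableSet (g ⁻¹' {i}))
    (x : ι → Measure X) {s : Set X} (hs : MeasurableSet s) :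
    mixture ρ g x s = ∫⁻ ω, x (g ω) s ∂ρ := by
  simpa [lintegral_indicator_one hs] using lintegral_mixture ρ hg x (s.indicator 1)

theorem isProbabilityMeasure_mixture [Countable ι] (ρ : Measure Ω) [IsProbabilityMeasure ρ]
    {g : Ω → ι} (hg : ∀ i, MeasurableSet (g ⁻¹' {i})) (x : ι → Measure X)
    [∀ i, IsProbabilityMeasure (x i)] :
    IsProbabilityMeasure (mixture ρ g x) :=
  ⟨by simp [mixture_apply ρ hg x .univ]⟩

theorem innerRegular_mixture [TopologicalSpace X] [BorelSpace X] (ρ : Measure Ω) (g : Ω → ι)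
    (x : ι → Measure X) [∀ i, (x i).InnerRegular] : (mixture ρ g x).InnerRegular := by
  unfold mixture
  infer_instance

end Mixture

theorem exists_isProbabilityMeasure_nullSingletonClass :
    ∃ ρ : Measure (ℕ → Bool), IsProbabilityMeasure ρ ∧ ∀ β, ρ {β} = 0 := by
  obtain ⟨j, hj, hinj⟩ :=
    MeasurableSpace.measurable_injection_nat_bool_of_countablySeparated unitInterval
  refine ⟨(volume : Measure unitInterval).map j,
    Measure.isProbabilityMeasure_map hj.aemeasurable, fun β ↦ ?_⟩
  rw [Measure.map_apply hj (measurableSet_singleton β)]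
  exact (subsingleton_singleton.preimage hinj).measure_zero _

variable {X : Type*} [TopologicalSpace X] [MeasurableSpace X] [BorelSpace X]

/-- The mixture of the measures met at the endpoints of a random walk. -/
noncomputable def endpointMixture (ρ : Measure (ℕ → Bool)) [IsProbabilityMeasure ρ]
    (x : List ℕ → {μ : ProbabilityMeasure X // μ.toMeasure.InnerRegular})
    (a : List Bool → ℕ∞) : {μ : ProbabilityMeasure X // μ.toMeasure.InnerRegular} :=
  ⟨⟨mixture ρ (BranchingConfig.endpoint a) fun s ↦ (x s).1.toMeasure,
    isProbabilityMeasure_mixture ρ (BranchingConfig.measurableSet_endpoint a) _⟩, by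
    have (s : List ℕ) : (x s).1.toMeasure.InnerRegular := (x s).2
    exact innerRegular_mixture ρ _ _⟩

theorem ae_exists_halts {ρ : Measure (ℕ → Bool)} (hρ : ∀ β, ρ {β} = 0) {a : List Bool → ℕ∞}
    (ha : a ∈ BranchingConfig.admissible) : ∀ᵐ β ∂ρ, ∃ n, BranchingConfig.Halts a β n := by
  have hsub : {β | ¬ ∃ n, BranchingConfig.Halts a β n}.Subsingleton := fun β hβ γ hγ ↦
    BranchingConfig.eq_of_forall_not_halts ha (not_exists.1 hβ) (not_exists.1 hγ)
  rcases hsub.eq_empty_or_singleton with h | ⟨β, h⟩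
  · exact measure_mono_null h.subset measure_empty
  · exact measure_mono_null h.subset (hρ β)

theorem continuous_endpointMixture {ρ : Measure (ℕ → Bool)} [IsProbabilityMeasure ρ]
    (hρ : ∀ β, ρ {β} = 0) {x : List ℕ → {μ : ProbabilityMeasure X // μ.toMeasure.InnerRegular}}
    {V : List ℕ → Set {μ : ProbabilityMeasure X // μ.toMeasure.InnerRegular}}
    (hxV : ∀ s, x s ∈ V s) (hV : ∀ m s, V (m :: s) ⊆ V s)
    (hlim : ∀ s, ∀ W ∈ 𝓝 (x s), ∀ᶠ m in atTop, V (m :: s) ⊆ W) :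
    Continuous fun a : BranchingConfig.admissible ↦ endpointMixture ρ x a := by
  refine SeqContinuous.continuous fun u c hu ↦ ?_
  rw [tendsto_subtype_rng, ProbabilityMeasure.tendsto_iff_forall_lintegral_tendsto]
  intro f
  obtain ⟨C, hC⟩ : ∃ C : ℝ≥0, ∀ y, f y ≤ C := ⟨nndist 0 f, f.apply_le_nndist_zero⟩
  have hint (a : List Bool → ℕ∞) : ∫⁻ y, f y ∂(endpointMixture ρ x a).1.toMeasure =
      ∫⁻ β, ∫⁻ y, f y ∂(x (BranchingConfig.endpoint a β)).1.toMeasure ∂ρ :=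
    lintegral_mixture ρ (BranchingConfig.measurableSet_endpoint a) _ _
  change Tendsto (fun n ↦ ∫⁻ y, f y ∂(endpointMixture ρ x (u n)).1.toMeasure) atTop
    (𝓝 (∫⁻ y, f y ∂(endpointMixture ρ x c).1.toMeasure))
  simp only [hint]
  refine tendsto_lintegral_of_dominated_convergence (μ := ρ) (fun _ ↦ (C : ℝ≥0∞)) (fun n ↦ ?_)
    (fun n ↦ .of_forall fun β ↦ ?_) (by simp) ?_
  · exact measurable_comp_of_countable (BranchingConfig.measurableSet_endpoint _)
      fun s ↦ ∫⁻ y, f y ∂(x s).1.toMeasure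
  · refine (lintegral_mono fun y ↦ ENNReal.coe_le_coe.2 (hC y)).trans_eq ?_
    simp
  · filter_upwards [ae_exists_halts hρ c.2, ae_all_iff.2 fun n ↦ ae_exists_halts hρ (u n).2]
      with β hc hun
    have := BranchingConfig.tendsto_endpoint hxV hV hlim
      ((continuous_subtype_val.tendsto c).comp hu) hc hun
    rw [tendsto_subtype_rng, ProbabilityMeasure.tendsto_iff_forall_lintegral_tendsto] at this
    exact this f

theorem isCompact_setOf_measure_compl_le [TopologicalSpace.MetrizableSpace X] {r : ℕ → ℝ≥0}
    {K : ℕ → Set X} (hr : Tendsto r atTop (𝓝 0)) (hK : ∀ n, IsCompact (K n)) :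
    IsCompact {μ : {μ : ProbabilityMeasure X // μ.toMeasure.InnerRegular} |
      ∀ n, μ.1 (K n)ᶜ ≤ r n} := by
  have hcomp := isCompact_setOfPred_probabilityMeasure_mass_eq_compl_isCompact_le hr hK
    (Or.inl inferInstance)
  refine (IsInducing.subtypeVal.isCompact_preimage_iff fun μ hμ ↦ ?_).2 hcomp
  refine ⟨⟨μ, innerRegular_of_forall_exists_isCompact fun ε hε ↦ ?_⟩, rfl⟩
  have hr' : Tendsto (fun n ↦ (r n : ℝ≥0∞)) atTop (𝓝 0) := by
    rw [← ENNReal.coe_zero]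
    exact ENNReal.tendsto_coe.2 hr
  obtain ⟨n, hn⟩ := (hr'.eventually (gt_mem_nhds hε)).exists
  refine ⟨K n, hK n, lt_of_le_of_lt ?_ hn⟩
  rw [← ProbabilityMeasure.ennreal_coeFn_eq_coeFn_toMeasure]
  exact ENNReal.coe_le_coe.2 (hμ n)

end MeasureTheory

theorem Prohorov.exists_isCompact_path {X : Type*} [TopologicalSpace X]
    [TopologicalSpace.MetrizableSpace X] [MeasurableSpace X] [BorelSpace X] (h : Prohorov X)
    {x : List ℕ → {μ : ProbabilityMeasure X // μ.toMeasure.InnerRegular}}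
    {V : List ℕ → Set {μ : ProbabilityMeasure X // μ.toMeasure.InnerRegular}}
    (hxV : ∀ s, x s ∈ V s) (hV : ∀ m s, V (m :: s) ⊆ V s)
    (hlim : ∀ s, ∀ W ∈ 𝓝 (x s), ∀ᶠ m in atTop, V (m :: s) ⊆ W) :
    ∃ 𝒦 : Set {μ : ProbabilityMeasure X // μ.toMeasure.InnerRegular}, IsCompact 𝒦 ∧
      ∃ σ : ℕ → List ℕ, σ 0 = [] ∧ ∀ n, x (σ n) ∈ 𝒦 ∧ ∃ m, σ (n + 1) = m :: σ n := by
  obtain ⟨ρ, hρ, hρ0⟩ := exists_isProbabilityMeasure_nullSingletonClass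
  have : CompactSpace BranchingConfig.admissible :=
    isCompact_iff_compactSpace.1 BranchingConfig.isClosed_admissible.isCompact
  have hrange := isCompact_range (continuous_endpointMixture hρ0 hxV hV hlim)
  choose K hK hKε using fun n : ℕ ↦ h _ hrange ((1 / 4) ^ (n + 1)) (by positivity)
  refine ⟨_, isCompact_setOf_measure_compl_le
    (NNReal.tendsto_pow_atTop_nhds_zero_of_lt_one (r := 1 / 2) (by norm_num)) hK, ?_⟩
  by_contra hpath
  obtain ⟨a, ha, hβ⟩ := BranchingConfig.exists_admissible_endpoint_notMem
    (T := {s | ∀ n, (x s).1 (K n)ᶜ ≤ (1 / 2) ^ n}) hpath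
  have hend := BranchingConfig.measurableSet_endpoint a
  have hsmall (n : ℕ) : (endpointMixture ρ x a).1.toMeasure (K n)ᶜ ≤
      ((1 / 4 : ℝ≥0) ^ (n + 1) : ℝ≥0) := by
    have hlt := hKε n _ ⟨⟨a, ha⟩, rfl⟩
    rw [prob_compl_eq_one_sub (hK n).measurableSet, tsub_le_iff_right,
      ← ProbabilityMeasure.ennreal_coeFn_eq_coeFn_toMeasure]
    norm_cast
    rw [← NNReal.coe_le_coe]
    push_cast
    linarith
  have hlarge (β : ℕ → Bool) : 1 ≤ ∑' n : ℕ, ((2 ^ n : ℝ≥0) : ℝ≥0∞) *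
      (x (BranchingConfig.endpoint a β)).1.toMeasure (K n)ᶜ := by
    obtain ⟨n, hn⟩ : ∃ n, (1 / 2 : ℝ≥0) ^ n < (x (BranchingConfig.endpoint a β)).1 (K n)ᶜ := by
      by_contra! hle
      exact (hβ β).2 hle
    refine le_trans ?_ (ENNReal.le_tsum n)
    rw [← ProbabilityMeasure.ennreal_coeFn_eq_coeFn_toMeasure, ← ENNReal.coe_mul,
      ← ENNReal.coe_one, ENNReal.coe_le_coe]
    calc (1 : ℝ≥0) = 2 ^ n * (1 / 2) ^ n := by rw [← mul_pow]; norm_num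
      _ ≤ _ := by gcongr
  have hsum : ∑' n : ℕ, (((1 / 2) ^ n / 4 : ℝ≥0) : ℝ≥0∞) = ((1 / 2 : ℝ≥0) : ℝ≥0∞) := by
    refine ENNReal.tsum_coe_eq (NNReal.hasSum_coe.1 ?_)
    have hhalf : ((1 / 2 : ℝ≥0) : ℝ) = 2 / 4 := by norm_num
    rw [hhalf]
    push_cast
    exact hasSum_geometric_two.div_const 4
  have hcontra : (1 : ℝ≥0∞) ≤ ((1 / 2 : ℝ≥0) : ℝ≥0∞) :=
    calc (1 : ℝ≥0∞) = ∫⁻ _, 1 ∂ρ := by simp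
      _ ≤ ∫⁻ β, ∑' n : ℕ, ((2 ^ n : ℝ≥0) : ℝ≥0∞) *
          (x (BranchingConfig.endpoint a β)).1.toMeasure (K n)ᶜ ∂ρ := lintegral_mono hlarge
      _ = ∑' n : ℕ, ((2 ^ n : ℝ≥0) : ℝ≥0∞) * (endpointMixture ρ x a).1.toMeasure (K n)ᶜ := by
        have hmeas (n : ℕ) := measurable_comp_of_countable hend
          fun s ↦ (x s).1.toMeasure (K n)ᶜ
        rw [lintegral_tsum fun n ↦ ((hmeas n).const_mul _).aemeasurable]
        refine tsum_congr fun n ↦ ?_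
        rw [lintegral_const_mul _ (hmeas n)]
        exact congrArg _
          (mixture_apply ρ hend (fun s ↦ (x s).1.toMeasure) (hK n).measurableSet.compl).symm
      _ ≤ ∑' n : ℕ, (((1 / 2) ^ n / 4 : ℝ≥0) : ℝ≥0∞) := by
        refine ENNReal.tsum_le_tsum fun n ↦ (mul_le_mul_right (hsmall n) _).trans_eq ?_
        rw [← ENNReal.coe_mul, pow_succ, ← mul_assoc, ← mul_pow, div_eq_mul_one_div (_ ^ n)]
        norm_num
      _ = _ := hsum
  norm_cast at hcontra
  norm_num [← NNReal.coe_le_coe] at hcontra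

end Auxiliary

open Filter Topology Set in
/-- If `X` is a metrizable Prohorov space, then `P_r(X)` is hereditarily
Baire. -/
theorem radon_measures_hereditarilyBaire_of_prohorov {X : Type*}
    [TopologicalSpace X] [TopologicalSpace.MetrizableSpace X] [MeasurableSpace X]
    [BorelSpace X] (h : Prohorov X) :
    HereditarilyBaire {μ : ProbabilityMeasure X // μ.toMeasure.InnerRegular} := by
  intro C hC
  by_contra hBaire
  obtain ⟨x, V, hxV, hV, hlim, hempty⟩ := exists_openScheme_of_not_baireSpace hBaire
  obtain ⟨𝒦, h𝒦, σ, h0, hσ⟩ := h.exists_isCompact_path (x := fun s ↦ (x s).1)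
    (V := fun s ↦ Subtype.val '' V s) (fun s ↦ mem_image_of_mem _ (hxV s))
    (fun m s ↦ image_mono (hV m s)) fun s W hW ↦ by
      filter_upwards [hlim s _ (continuous_subtype_val.continuousAt hW)] with m hm
      exact image_subset_iff.2 hm
  have hcomp : IsCompact (Subtype.val ⁻¹' 𝒦 : Set C) :=
    hC.isClosedEmbedding_subtypeVal.isCompact_preimage h𝒦
  obtain ⟨z, -, hz⟩ := hcomp.exists_mapClusterPt_of_frequently (l := atTop)
    (f := fun n ↦ x (σ n)) (Frequently.of_forall fun n ↦ (hσ n).1)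
  have hanti : Antitone fun n ↦ V (σ n) := antitone_nat_of_succ_le fun n ↦ by
    obtain ⟨m, hm⟩ := (hσ n).2
    rw [hm]
    exact hV m _
  refine (hempty σ h0 fun n ↦ (hσ n).2).subset (mem_iInter.2 fun n ↦ ?_ : z ∈ _)
  refine isClosed_closure.mem_of_mapClusterPt hz ?_
  filter_upwards [eventually_ge_atTop n] with k hk
  exact subset_closure (hanti hk (hxV _))
end
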